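/- arXiv:2302.06257 — 2 statements merged into one kernel-verified Lean document; each statement's English description precedes it below -/
import Mathlib

section
/- Let G be a finite non-abelian p-group with cyclic center, with p^e = max cd(G), exp(G) = p^b, and p^α = min{χ(1) : χ ∈ Irr(G), χ faithful}. Then p^α·|Z(G)| divides c(G) and c(G) divides p^{e+b}. In particular, if cd(G) = {1, p, p^e} with e > 1 and exp(G) = p, then c(G) = p^{e+1}. -/
open FDRep CategoryTheory Subgroup

/-- The minimal faithful permutation degree of `G`. -/
noncomputable def permDegree (G : Type*) [Group G] : ℕ :=
  sInf {n | ∃ f : G →* Equiv.Perm (Fin n), Function.Injective f}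

/-- The minimal degree of a faithful quasi-permutation representation of `G` over `ℂ`:
a faithful matrix representation in which every element has non-negative integral trace. -/
noncomputable def quasiPermDegree (G : Type*) [Group G] : ℕ :=
  sInf {n | ∃ ρ : G →* Matrix.GeneralLinearGroup (Fin n) ℂ,
    Function.Injective ρ ∧ ∀ g : G, ∃ m : ℕ, Matrix.trace ((ρ g : Matrix (Fin n) (Fin n) ℂ)) = (m : ℂ)}

/-- The set of degrees of irreducible complex characters of `G`. -/
def cdSet (G : Type) [Group G] : Set ℕ :=
  {n | ∃ V : FDRep ℂ G, Simple V ∧ Module.finrank ℂ V = n}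

/-- The minimal number of generators of `G`. -/
noncomputable def minGens (G : Type*) [Group G] : ℕ :=
  sInf {n | ∃ S : Finset G, S.card = n ∧ Subgroup.closure (S : Set G) = ⊤}

section

open Module

/-- The powers of an endomorphism of finite order have the traces dictated by its eigenvalues. -/
theorem exists_trace_pow_eq_sum {V : Type*} [AddCommGroup V] [Module ℂ V] [FiniteDimensional ℂ V]
    {N : ℕ} (hN : N ≠ 0) (f : End ℂ V) (hf : f ^ N = 1) :
    ∃ m : ℂ → ℕ, ∀ i : ℕ, LinearMap.trace ℂ V (f ^ i) =
      ∑ μ ∈ Polynomial.nthRootsFinset N (1 : ℂ), m μ * μ ^ i := by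
  have hss : f.IsSemisimple := by
    refine End.isSemisimple_of_squarefree_aeval_eq_zero (p := Polynomial.X ^ N - 1)
      (Polynomial.Separable.squarefree ?_) (by simp [hf])
    exact (Polynomial.X_pow_sub_one_separable_iff).2 (by exact_mod_cast hN)
  have hint : DirectSum.IsInternal f.eigenspace :=
    DirectSum.isInternal_submodule_of_iSupIndep_of_iSup_eq_top f.eigenspaces_iSupIndep
      hss.iSup_eigenspace_eq_top
  have hroot : ∀ μ : ℂ, f.eigenspace μ ≠ ⊥ → μ ∈ Polynomial.nthRootsFinset N (1 : ℂ) := by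
    intro μ hμ
    obtain ⟨v, hv, hv0⟩ := Submodule.exists_mem_ne_zero_of_ne_bot hμ
    have h := (show f.HasEigenvector μ v from ⟨hv, hv0⟩).pow_apply N
    rw [hf, End.one_apply] at h
    rw [Polynomial.mem_nthRootsFinset (Nat.pos_of_ne_zero hN)]
    have : (μ ^ N - 1) • v = 0 := by rw [sub_smul, ← h, one_smul, sub_self]
    exact sub_eq_zero.1 ((smul_eq_zero.1 this).resolve_right hv0)
  have hfin : {μ | f.eigenspace μ ≠ ⊥}.Finite :=
    (Polynomial.nthRootsFinset N (1 : ℂ)).finite_toSet.subset hroot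
  refine ⟨fun μ ↦ finrank ℂ (f.eigenspace μ), fun i ↦ ?_⟩
  have happ : ∀ μ : ℂ, ∀ v ∈ f.eigenspace μ, (f ^ i) v = μ ^ i • v := by
    intro μ v hv
    by_cases hv0 : v = 0
    · simp [hv0]
    · exact (show f.HasEigenvector μ v from ⟨hv, hv0⟩).pow_apply i
  have hmaps : ∀ μ : ℂ, Set.MapsTo (f ^ i) (f.eigenspace μ) (f.eigenspace μ) := by
    intro μ v hv
    rw [happ μ v hv]
    exact Submodule.smul_mem _ _ hv
  rw [LinearMap.trace_eq_sum_trace_restrict' hint hfin hmaps]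
  have htr : ∀ μ : ℂ, LinearMap.trace ℂ (f.eigenspace μ) ((f ^ i).restrict (hmaps μ)) =
      finrank ℂ (f.eigenspace μ) * μ ^ i := by
    intro μ
    have : (f ^ i).restrict (hmaps μ) = μ ^ i • (1 : End ℂ (f.eigenspace μ)) := by
      ext v
      exact happ μ v v.2
    rw [this, map_smul, LinearMap.trace_one, smul_eq_mul, mul_comm]
  simp_rw [htr]
  refine Finset.sum_subset (fun μ hμ ↦ hroot μ (by simpa using hμ)) (fun μ _ hμ ↦ ?_)
  have : f.eigenspace μ = ⊥ := by simpa using hμ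
  simp [this]

theorem exists_ringEquiv_pow {N u : ℕ} (hN : N ≠ 0) (hu : u.Coprime N) :
    ∃ σ : ℂ ≃+* ℂ, ∀ ζ : ℂ, ζ ^ N = 1 → σ ζ = ζ ^ u := by
  have : NeZero N := ⟨hN⟩
  let ζ : ℂ := Complex.exp (2 * Real.pi * Complex.I / N)
  have hζ : IsPrimitiveRoot ζ N := Complex.isPrimitiveRoot_exp N hN
  let K := IntermediateField.adjoin ℚ {ζ}
  have hcyc : IsCyclotomicExtension {N} ℚ K :=
    (IntermediateField.isCyclotomicExtension_singleton_iff_eq_adjoin N ℚ ℂ _ hζ).2 rfl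
  let z : K := ⟨ζ, IntermediateField.mem_adjoin_simple_self ℚ ζ⟩
  have hz : IsPrimitiveRoot z N := IsPrimitiveRoot.of_map_of_injective (f := algebraMap K ℂ)
    hζ (algebraMap K ℂ).injective
  let τ : K ≃ₐ[ℚ] K := IsCyclotomicExtension.fromZetaAut
    ((IsCyclotomicExtension.zeta_spec N ℚ K).pow_of_coprime u hu)
    (Polynomial.cyclotomic.irreducible_rat (Nat.pos_of_ne_zero hN))
  have hτ0 : τ (IsCyclotomicExtension.zeta N ℚ K) = IsCyclotomicExtension.zeta N ℚ K ^ u :=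
    IsCyclotomicExtension.fromZetaAut_spec _ _
  obtain ⟨k, -, hk⟩ := (IsCyclotomicExtension.zeta_spec N ℚ K).eq_pow_of_pow_eq_one hz.pow_eq_one
  have hτ : τ z = z ^ u := by rw [← hk, map_pow, hτ0, ← pow_mul, ← pow_mul, mul_comm]
  obtain ⟨s, hs⟩ := exists_isTranscendenceBasis K ℂ
  have := IsAlgClosed.isAlgClosure_of_transcendence_basis _ hs
  let e : Algebra.adjoin K (Set.range ((↑) : s → ℂ)) ≃+*
      Algebra.adjoin K (Set.range ((↑) : s → ℂ)) :=
    (hs.1.aevalEquiv.symm.toRingEquiv.trans (MvPolynomial.mapEquiv s τ.toRingEquiv)).trans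
      hs.1.aevalEquiv.toRingEquiv
  let σ : ℂ ≃+* ℂ := IsAlgClosure.equivOfEquiv ℂ ℂ e
  have hσK : ∀ x : K, σ (algebraMap K ℂ x) = algebraMap K ℂ (τ x) := by
    intro x
    have h1 := IsAlgClosure.equivOfEquiv_algebraMap ℂ ℂ e (algebraMap K _ x)
    have h2 : e (algebraMap K _ x) = algebraMap K _ (τ x) := by
      have : hs.1.aevalEquiv.symm (algebraMap K _ x) = MvPolynomial.C x := by
        rw [AlgEquiv.commutes]; rfl
      simp only [e, RingEquiv.trans_apply, AlgEquiv.coe_ringEquiv, this,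
        MvPolynomial.mapEquiv_apply, MvPolynomial.map_C]
      exact hs.1.aevalEquiv.commutes (τ x)
    rw [h2] at h1
    exact h1
  refine ⟨σ, fun w hw ↦ ?_⟩
  obtain ⟨i, -, rfl⟩ := hζ.eq_pow_of_pow_eq_one hw
  have : σ ζ = ζ ^ u := by
    have := hσK z
    rw [hτ] at this
    exact this
  rw [map_pow, this, ← pow_mul, ← pow_mul, mul_comm]

theorem map_trace_of_pow_eq_one {V : Type*} [AddCommGroup V] [Module ℂ V] [FiniteDimensional ℂ V]
    {N u : ℕ} (hN : N ≠ 0) (σ : ℂ →+* ℂ) (hσ : ∀ ζ : ℂ, ζ ^ N = 1 → σ ζ = ζ ^ u)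
    (f : End ℂ V) (hf : f ^ N = 1) :
    σ (LinearMap.trace ℂ V f) = LinearMap.trace ℂ V (f ^ u) := by
  obtain ⟨m, hm⟩ := exists_trace_pow_eq_sum hN f hf
  rw [hm u, ← pow_one f, hm 1, map_sum]
  refine Finset.sum_congr rfl fun μ hμ ↦ ?_
  rw [Polynomial.mem_nthRootsFinset (Nat.pos_of_ne_zero hN)] at hμ
  rw [map_mul, map_natCast, pow_one, hσ μ hμ]

theorem geom_sum_eq_ite {N : ℕ} {μ : ℂ} (hμ : μ ^ N = 1) :
    ∑ i ∈ Finset.range N, μ ^ i = if μ = 1 then (N : ℂ) else 0 := by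
  split_ifs with h
  · simp [h]
  · rw [geom_sum_eq h, hμ, sub_self, zero_div]

theorem sum_units_zmod_eq {M : Type*} [AddCommMonoid M] {N : ℕ} [NeZero N] (F : ℕ → M) :
    ∑ u : (ZMod N)ˣ, F (u : ZMod N).val = ∑ i ∈ Finset.range N with i.Coprime N, F i := by
  refine Finset.sum_bij (fun u _ ↦ (u : ZMod N).val) (fun u _ ↦ ?_) (fun u _ v _ h ↦ ?_)
    (fun i hi ↦ ?_) (fun _ _ ↦ rfl)
  · simpa [ZMod.val_lt] using ZMod.val_coe_unit_coprime u
  · exact Units.ext (ZMod.val_injective N h)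
  · rw [Finset.mem_filter, Finset.mem_range] at hi
    exact ⟨ZMod.unitOfCoprime i hi.2, Finset.mem_univ _, by
      rw [ZMod.coe_unitOfCoprime, ZMod.val_cast_of_lt hi.1]⟩

/-- Evaluation of Ramanujan sums for prime powers. -/
theorem sum_units_zmod_pow {p b : ℕ} (hp : p.Prime) {μ : ℂ} (hμ : μ ^ p ^ (b + 1) = 1) :
    haveI : NeZero (p ^ (b + 1)) := ⟨pow_ne_zero _ hp.ne_zero⟩
    ∑ u : (ZMod (p ^ (b + 1)))ˣ, μ ^ (u : ZMod (p ^ (b + 1))).val =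
      (if μ = 1 then (p : ℂ) ^ (b + 1) else 0) - if μ ^ p = 1 then (p : ℂ) ^ b else 0 := by
  have : NeZero (p ^ (b + 1)) := ⟨pow_ne_zero _ hp.ne_zero⟩
  rw [sum_units_zmod_eq fun i ↦ μ ^ i]
  have hall := geom_sum_eq_ite hμ
  have hmul := geom_sum_eq_ite (N := p ^ b) (μ := μ ^ p) (by rw [← pow_mul, ← pow_succ', hμ])
  have hsplit := Finset.sum_filter_add_sum_filter_not (Finset.range (p ^ (b + 1)))
    (fun i ↦ i.Coprime (p ^ (b + 1))) (fun i ↦ μ ^ i)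
  have hdvd : ∑ i ∈ Finset.range (p ^ (b + 1)) with ¬ i.Coprime (p ^ (b + 1)), μ ^ i =
      ∑ i ∈ Finset.range (p ^ b), (μ ^ p) ^ i := by
    symm
    refine Finset.sum_bij (fun i _ ↦ p * i) (fun i hi ↦ ?_)
      (fun i _ j _ h ↦ Nat.eq_of_mul_eq_mul_left hp.pos h) (fun i hi ↦ ?_)
      (fun i _ ↦ by rw [pow_mul])
    · rw [Finset.mem_range] at hi
      rw [Finset.mem_filter, Finset.mem_range, pow_succ']
      refine ⟨Nat.mul_lt_mul_of_pos_left hi hp.pos, fun h ↦ hp.one_lt.ne' ?_⟩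
      exact Nat.eq_one_of_dvd_coprimes h (Dvd.intro _ rfl) (Dvd.intro _ rfl)
    · rw [Finset.mem_filter, Finset.mem_range, Nat.coprime_pow_right_iff (Nat.succ_pos b),
        Nat.coprime_comm, hp.coprime_iff_not_dvd, not_not] at hi
      obtain ⟨hi, k, rfl⟩ := hi
      rw [pow_succ'] at hi
      exact ⟨k, Finset.mem_range.2 (Nat.lt_of_mul_lt_mul_left hi), rfl⟩
  rw [hdvd, hmul, hall] at hsplit
  push_cast at hsplit
  exact eq_sub_of_add_eq hsplit

theorem exists_sum_trace_pow_add_eq {V : Type*} [AddCommGroup V] [Module ℂ V]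
    [FiniteDimensional ℂ V] {p b : ℕ} (hp : p.Prime) (f : End ℂ V) (hf : f ^ p ^ (b + 1) = 1) :
    haveI : NeZero (p ^ (b + 1)) := ⟨pow_ne_zero _ hp.ne_zero⟩
    ∃ t : ℕ, ∑ u : (ZMod (p ^ (b + 1)))ˣ,
      LinearMap.trace ℂ V (f ^ (u : ZMod (p ^ (b + 1))).val) + (p ^ b * finrank ℂ V : ℕ) =
        (p ^ b * t : ℕ) := by
  have hN : p ^ (b + 1) ≠ 0 := pow_ne_zero _ hp.ne_zero
  obtain ⟨m, hm⟩ := exists_trace_pow_eq_sum hN f hf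
  have h0 : (finrank ℂ V : ℂ) =
      ∑ μ ∈ Polynomial.nthRootsFinset (p ^ (b + 1)) (1 : ℂ), (m μ : ℂ) := by
    simpa using hm 0
  refine ⟨∑ μ ∈ Polynomial.nthRootsFinset (p ^ (b + 1)) (1 : ℂ),
    m μ * if μ = 1 then p else if μ ^ p = 1 then 0 else 1, ?_⟩
  simp_rw [hm]
  rw [Finset.sum_comm]
  simp_rw [← Finset.mul_sum]
  push_cast
  rw [h0, Finset.mul_sum, Finset.mul_sum, ← Finset.sum_add_distrib]
  refine Finset.sum_congr rfl fun μ hμ ↦ ?_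
  rw [Polynomial.mem_nthRootsFinset (Nat.pos_of_ne_zero hN)] at hμ
  rw [sum_units_zmod_pow hp hμ]
  by_cases h1 : μ = 1
  · simp [h1]
    ring
  · by_cases h2 : μ ^ p = 1
    · simp [h1, h2]
      ring
    · simp [h1, h2]

namespace Representation

section Schur

variable {G V W : Type*} [Group G] [AddCommGroup V] [Module ℂ V] [FiniteDimensional ℂ V]
  [AddCommGroup W] [Module ℂ W] [FiniteDimensional ℂ W]

omit [FiniteDimensional ℂ V] in
theorem nontrivial_of_isIrreducible (ρ : Representation ℂ G V) [IsIrreducible ρ] :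
    Nontrivial V := by
  by_contra h
  rw [not_nontrivial_iff_subsingleton] at h
  refine bot_ne_top (α := Subrepresentation ρ) (Subrepresentation.toSubmodule_injective ?_)
  exact Subsingleton.elim _ _

theorem exists_eq_smul_one_of_commute (ρ : Representation ℂ G V) [IsIrreducible ρ] (f : End ℂ V)
    (hf : ∀ g v, f (ρ g v) = ρ g (f v)) : ∃ c : ℂ, f = c • (1 : End ℂ V) := by
  let F : IntertwiningMap ρ ρ := f.intertwiningMap_of_isIntertwiningMap ρ ρ hf
  obtain ⟨c, hc⟩ := (IsIrreducible.algebraMap_intertwiningMap_bijective_of_isAlgClosed (ρ := ρ)).2 F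
  refine ⟨c, LinearMap.ext fun v ↦ ?_⟩
  exact (congrArg (fun T : IntertwiningMap ρ ρ ↦ T v) hc).symm

variable [Fintype G]

theorem sum_character_mul_character_inv_eq_finrank (ρ : Representation ℂ G V)
    (σ : Representation ℂ G W) :
    ∑ g, σ.character g * ρ.character g⁻¹ = Nat.card G * finrank ℂ (IntertwiningMap ρ σ) := by
  have := invertibleOfNonzero (NeZero.ne (Nat.card G : ℂ))
  rw [← card_inv_mul_sum_char_mul_char_eq_finrank, mul_inv_cancel_left₀ (NeZero.ne _)]

theorem sum_character_mul_character_inv_self (ρ : Representation ℂ G V) [IsIrreducible ρ] :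
    ∑ g, ρ.character g * ρ.character g⁻¹ = Nat.card G := by
  rw [sum_character_mul_character_inv_eq_finrank, IsIrreducible.finrank_intertwiningMap_self]
  simp

theorem sum_character_mul_character_inv_of_ne (ρ : Representation ℂ G V)
    (σ : Representation ℂ G W) [IsIrreducible ρ] [IsIrreducible σ]
    (h : ρ.character ≠ σ.character) : ∑ g, σ.character g * ρ.character g⁻¹ = 0 := by
  have : IsEmpty (Equiv ρ σ) := ⟨fun e ↦ h (char_iso e)⟩
  rw [sum_character_mul_character_inv_eq_finrank, finrank_zero_of_subsingleton]
  simp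

theorem isIrreducible_of_sum_character_mul_character_inv (ρ : Representation ℂ G V)
    (h : ∑ g, ρ.character g * ρ.character g⁻¹ = Nat.card G) : IsIrreducible ρ := by
  rw [sum_character_mul_character_inv_eq_finrank] at h
  have hrank : finrank ℂ (IntertwiningMap ρ ρ) = 1 := by
    have := mul_left_cancel₀ (NeZero.ne (Nat.card G : ℂ)) (h.trans (mul_one _).symm)
    exact_mod_cast this
  have hid : (1 : IntertwiningMap ρ ρ) ≠ 0 := by
    intro h0
    have : Subsingleton (IntertwiningMap ρ ρ) :=
      ⟨fun a b ↦ by rw [← mul_one a, ← mul_one b, h0, mul_zero, mul_zero]⟩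
    simp [finrank_zero_of_subsingleton] at hrank
  have hnt : Nontrivial V := by
    by_contra hV
    rw [not_nontrivial_iff_subsingleton] at hV
    exact hid (IntertwiningMap.ext (LinearMap.ext fun v ↦ Subsingleton.elim _ _))
  have hnt' : Nontrivial (Subrepresentation ρ) := by
    refine ⟨⟨⊥, ⊤, fun h ↦ ?_⟩⟩
    have := congrArg Subrepresentation.toSubmodule h
    exact bot_ne_top (α := Submodule ℂ V) this
  refine { eq_bot_or_eq_top := fun S ↦ ?_ }
  obtain ⟨T, hST⟩ := exists_isCompl S
  have hcompl : IsCompl S.toSubmodule T.toSubmodule := by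
    constructor
    · rw [disjoint_iff]
      exact congrArg Subrepresentation.toSubmodule hST.inf_eq_bot
    · rw [codisjoint_iff]
      exact congrArg Subrepresentation.toSubmodule hST.sup_eq_top
  let P : End ℂ V := S.toSubmodule.projection T.toSubmodule hcompl
  have h1 : ∀ x ∈ S.toSubmodule, P x = x := fun x hx ↦
    Submodule.projection_apply_of_mem_left hcompl hx
  have h2 : ∀ x ∈ T.toSubmodule, P x = 0 := fun x hx ↦
    Submodule.projection_apply_of_mem_right hcompl hx
  have hP : ∀ g v, P (ρ g v) = ρ g (P v) := by
    intro g v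
    obtain ⟨s, t, rfl, -⟩ := Submodule.existsUnique_add_of_isCompl hcompl v
    rw [map_add, map_add, map_add, map_add, h1 _ s.2, h2 _ t.2,
      h1 _ (S.apply_mem_toSubmodule g s.2),
      h2 _ (T.apply_mem_toSubmodule g t.2), map_zero, add_zero]
  obtain ⟨c, hc⟩ := (finrank_eq_one_iff_of_nonzero' _ hid).1 hrank
    (P.intertwiningMap_of_isIntertwiningMap ρ ρ hP)
  have hc' : ∀ v, P v = c • v := fun v ↦
    (congrArg (fun T : IntertwiningMap ρ ρ ↦ T v) hc).symm
  by_cases hc0 : c = 0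
  · left
    refine Subrepresentation.toSubmodule_injective ((Submodule.eq_bot_iff _).2 fun x hx ↦ ?_)
    rw [← h1 x hx, hc', hc0, zero_smul]
  · right
    have hT : T.toSubmodule = ⊥ := (Submodule.eq_bot_iff _).2 fun x hx ↦ by
      have := hc' x
      rw [h2 x hx] at this
      exact (smul_eq_zero.1 this.symm).resolve_left hc0
    refine Subrepresentation.toSubmodule_injective ?_
    have := hcompl.sup_eq_top
    rwa [hT, sup_bot_eq] at this

end Schur

end Representation

theorem FDRep.simple_iff_isIrreducible {G : Type} [Group G] [Finite G] (V : FDRep ℂ G) :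
    CategoryTheory.Simple V ↔ Representation.IsIrreducible V.ρ := by
  have := Fintype.ofFinite G
  rw [FDRep.simple_iff_char_is_norm_one]
  exact ⟨fun h ↦ Representation.isIrreducible_of_sum_character_mul_character_inv V.ρ h,
    fun _ ↦ Representation.sum_character_mul_character_inv_self V.ρ⟩

namespace Representation

section Conj

variable {G V W : Type*} [Group G] [AddCommGroup V] [Module ℂ V] [FiniteDimensional ℂ V]
  [AddCommGroup W] [Module ℂ W] [FiniteDimensional ℂ W]

/-- The conjugate of a complex representation by a field endomorphism. -/
theorem exists_character_eq_map (ρ : Representation ℂ G V) (σ : ℂ →+* ℂ) :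
    ∃ R : Representation ℂ G (Fin (finrank ℂ V) → ℂ),
      (∀ g, R.character g = σ (ρ.character g)) ∧ ∀ g, R g = 1 → ρ g = 1 := by
  let B := finBasis ℂ V
  let R : Representation ℂ G (Fin (finrank ℂ V) → ℂ) :=
    ((Matrix.toLinAlgEquiv' (R := ℂ)).toMulEquiv.toMonoidHom.comp
      (σ.mapMatrix.toMonoidHom.comp (LinearMap.toMatrixAlgEquiv B).toMulEquiv.toMonoidHom)).comp ρ
  have hR : ∀ g, R g = Matrix.toLin' (σ.mapMatrix (LinearMap.toMatrix B B (ρ g))) := fun _ ↦ rfl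
  refine ⟨R, fun g ↦ ?_, fun g hg ↦ ?_⟩
  · rw [character, hR, Matrix.trace_toLin'_eq, character, LinearMap.trace_eq_matrix_trace ℂ B,
      Matrix.trace, Matrix.trace, map_sum]
    rfl
  · rw [hR] at hg
    have h1 : σ.mapMatrix (LinearMap.toMatrix B B (ρ g)) = 1 :=
      Matrix.toLin'.injective (hg.trans Matrix.toLin'_one.symm)
    have h2 : LinearMap.toMatrix B B (ρ g) = 1 :=
      Matrix.map_injective σ.injective (h1.trans (map_one σ.mapMatrix).symm)
    exact (LinearMap.toMatrix B B).injective (h2.trans (LinearMap.toMatrix_one B).symm)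

variable [Fintype G]

theorem isIrreducible_of_character_eq_map {ρ : Representation ℂ G V} [IsIrreducible ρ]
    {R : Representation ℂ G W} {σ : ℂ →+* ℂ} (h : ∀ g, R.character g = σ (ρ.character g)) :
    IsIrreducible R := by
  refine isIrreducible_of_sum_character_mul_character_inv R ?_
  simp_rw [h, ← map_mul, ← map_sum, sum_character_mul_character_inv_self, map_natCast]

omit [FiniteDimensional ℂ V] in
theorem exists_sum_character_inv_smul_eq (ρ : Representation ℂ G V) (R : Representation ℂ G W)
    [IsIrreducible R] : ∃ c : ℂ, ∑ g, ρ.character g⁻¹ • R g = c • (1 : End ℂ W) ∧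
      c * finrank ℂ W = ∑ g, R.character g * ρ.character g⁻¹ := by
  obtain ⟨c, hc⟩ := exists_eq_smul_one_of_commute R (∑ g, ρ.character g⁻¹ • R g) fun h v ↦ by
    simp only [LinearMap.sum_apply, LinearMap.smul_apply, map_sum, map_smul]
    refine Fintype.sum_bijective (fun g ↦ h⁻¹ * g * h) ?_ _ _ fun g ↦ ?_
    · convert (MulAut.conj h⁻¹).bijective using 2 with g
      simp
    · rw [← Module.End.mul_apply, ← map_mul, ← Module.End.mul_apply, ← map_mul]
      have : (h⁻¹ * g * h)⁻¹ = h⁻¹ * g⁻¹ * (h⁻¹)⁻¹ := by group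
      rw [this, char_conj]
      congr 3
      group
  refine ⟨c, hc, ?_⟩
  have := congrArg (LinearMap.trace ℂ W) hc
  rw [map_smul, LinearMap.trace_one, smul_eq_mul] at this
  rw [← this, map_sum]
  refine Finset.sum_congr rfl fun g _ ↦ ?_
  rw [map_smul, smul_eq_mul, mul_comm]
  rfl

theorem isIntegral_character (ρ : Representation ℂ G V) (g : G) : IsIntegral ℤ (ρ.character g) := by
  obtain ⟨m, hm⟩ := exists_trace_pow_eq_sum (N := Nat.card G) Nat.card_pos.ne' (ρ g)
    (by rw [← map_pow, pow_card_eq_one', map_one])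
  have := hm 1
  rw [pow_one] at this
  rw [character, this]
  refine IsIntegral.sum _ fun μ hμ ↦ ?_
  rw [Polynomial.mem_nthRootsFinset Nat.card_pos] at hμ
  have h1 : IsIntegral ℤ μ := IsIntegral.of_pow Nat.card_pos (hμ ▸ isIntegral_one)
  have h2 : IsIntegral ℤ (m μ : ℂ) := by
    have := isIntegral_algebraMap (R := ℤ) (A := ℂ) (x := (m μ : ℤ))
    simpa using this
  exact h2.mul (h1.pow 1)

/-- The degree of an irreducible complex representation divides the order of the group. -/
theorem finrank_dvd_card (ρ : Representation ℂ G V) [IsIrreducible ρ] :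
    finrank ℂ V ∣ Nat.card G := by
  obtain ⟨c, hc, hcd⟩ := exists_sum_character_inv_smul_eq ρ ρ
  rw [sum_character_mul_character_inv_self] at hcd
  have hd : (finrank ℂ V : ℂ) ≠ 0 := fun h ↦ NeZero.ne (Nat.card G : ℂ) (by rw [← hcd, h, mul_zero])
  have hnt : Nontrivial V := finrank_pos_iff.1 (Nat.pos_of_ne_zero (by exact_mod_cast hd))
  let A := integralClosure ℤ ℂ
  let x : MonoidAlgebra A G :=
    ∑ g, MonoidAlgebra.single g ⟨ρ.character g⁻¹, isIntegral_character ρ g⁻¹⟩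
  let F : MonoidAlgebra A G →ₐ[A] End ℂ V := MonoidAlgebra.lift A (End ℂ V) G ρ
  have hFx : F x = algebraMap ℂ (End ℂ V) c := by
    rw [Algebra.algebraMap_eq_smul_one, ← hc, map_sum]
    refine Finset.sum_congr rfl fun g _ ↦ ?_
    simp only [F, MonoidAlgebra.lift_single]
    rfl
  have hx : IsIntegral A x := IsIntegral.of_finite A x
  have h1 : IsIntegral A (algebraMap ℂ (End ℂ V) c) := hFx ▸ hx.map F
  have h2 : IsIntegral A c :=
    (isIntegral_algebraMap_iff (algebraMap ℂ (End ℂ V)).injective).1 h1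
  have h3 : IsIntegral ℤ c := isIntegral_trans c h2
  have hq : c = algebraMap ℚ ℂ (Nat.card G / finrank ℂ V : ℚ) := by
    rw [map_div₀, map_natCast, map_natCast, eq_div_iff hd, hcd]
  rw [hq, isIntegral_algebraMap_iff (algebraMap ℚ ℂ).injective,
    IsIntegrallyClosed.isIntegral_iff] at h3
  obtain ⟨y, hy⟩ := h3
  have hd' : (finrank ℂ V : ℚ) ≠ 0 := by exact_mod_cast hd
  rw [eq_div_iff hd', eq_comm] at hy
  refine Int.natCast_dvd_natCast.1 ⟨y, ?_⟩
  have : ((Nat.card G : ℤ) : ℚ) = (finrank ℂ V * y : ℤ) := by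
    push_cast
    rw [hy, mul_comm]
    rfl
  exact_mod_cast this

end Conj

end Representation

section PowOrbit

variable {G : Type*} [Group G] {N : ℕ}

/-- The Galois conjugate `g ↦ χ (g ^ u)` of a character `χ`, for `u` a unit modulo `N`. -/
def powConj (χ : G → ℂ) (u : (ZMod N)ˣ) : G → ℂ := fun g ↦ χ (g ^ (u : ZMod N).val)

open scoped Classical in
/-- The set of Galois conjugates of `χ`. -/
noncomputable def powOrbit (χ : G → ℂ) (N : ℕ) [NeZero N] : Finset (G → ℂ) :=
  Finset.univ.image (powConj (N := N) χ)

theorem pow_val_mul (hG : ∀ g : G, g ^ N = 1) (u v : (ZMod N)ˣ) (g : G) :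
    g ^ ((u * v : (ZMod N)ˣ) : ZMod N).val = (g ^ (v : ZMod N).val) ^ (u : ZMod N).val := by
  rw [← pow_mul, Units.val_mul, ZMod.val_mul, ← pow_eq_pow_mod _ (hG g), mul_comm]

theorem powConj_mul (hG : ∀ g : G, g ^ N = 1) (χ : G → ℂ) (u v : (ZMod N)ˣ) (g : G) :
    powConj χ (u * v) g = powConj χ u (g ^ (v : ZMod N).val) := by
  rw [powConj, powConj, pow_val_mul hG]

theorem powConj_one (hG : ∀ g : G, g ^ N = 1) (χ : G → ℂ) : powConj χ (1 : (ZMod N)ˣ) = χ := by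
  funext g
  rw [powConj]
  rcases eq_or_ne N 1 with rfl | h
  · have : ∀ x : G, x = 1 := fun x ↦ by simpa using hG x
    rw [this (g ^ _), this g]
  · rcases N with _ | N
    · simp
    · have : Fact (1 < N + 1) := ⟨by omega⟩
      rw [Units.val_one, ZMod.val_one, pow_one]

/-- The units modulo `N` which fix `χ`. -/
def powStabilizer (hG : ∀ g : G, g ^ N = 1) (χ : G → ℂ) : Subgroup (ZMod N)ˣ where
  carrier := {u | powConj χ u = χ}
  one_mem' := powConj_one hG χ
  mul_mem' {u v} hu hv := by
    rw [Set.mem_ofPred_eq] at *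
    funext g
    rw [powConj_mul hG, hu]
    exact congrFun hv g
  inv_mem' {u} hu := by
    rw [Set.mem_ofPred_eq] at *
    funext g
    have := powConj_mul hG χ u u⁻¹ g
    rw [mul_inv_cancel, powConj_one hG, hu] at this
    exact this.symm

theorem powConj_eq_iff (hG : ∀ g : G, g ^ N = 1) (χ : G → ℂ) (u v : (ZMod N)ˣ) :
    powConj χ u = powConj χ v ↔ u⁻¹ * v ∈ powStabilizer hG χ := by
  constructor
  · intro h
    change powConj χ (u⁻¹ * v) = χ
    funext g
    rw [mul_comm, powConj_mul hG, ← h, ← powConj_mul hG, mul_inv_cancel, powConj_one hG]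
  · intro h
    change powConj χ (u⁻¹ * v) = χ at h
    funext g
    rw [← inv_mul_cancel_right v u, mul_comm v, powConj_mul hG, h]
    rfl

theorem sum_powConj [NeZero N] (hG : ∀ g : G, g ^ N = 1) (χ : G → ℂ) {M : Type*}
    [AddCommMonoid M] (F : (G → ℂ) → M) :
    ∑ u : (ZMod N)ˣ, F (powConj χ u) =
      Nat.card (powStabilizer hG χ) • ∑ f ∈ powOrbit χ N, F f := by
  classical
  rw [Finset.sum_comp F (powConj χ), Finset.smul_sum, powOrbit]
  refine Finset.sum_congr (by congr!) fun f hf ↦ ?_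
  obtain ⟨v, -, rfl⟩ := Finset.mem_image.1 hf
  congr 1
  rw [← Nat.card_eq_finsetCard]
  refine Nat.card_congr ((Equiv.mulLeft v⁻¹).subtypeEquiv fun u ↦ ?_)
  rw [Finset.mem_filter, and_iff_right (Finset.mem_univ _), eq_comm, powConj_eq_iff hG]
  rfl

theorem self_mem_powOrbit [NeZero N] (hG : ∀ g : G, g ^ N = 1) (χ : G → ℂ) :
    χ ∈ powOrbit χ N :=
  by classical exact Finset.mem_image.2 ⟨1, Finset.mem_univ _, powConj_one hG χ⟩

end PowOrbit

theorem Representation.card_powStabilizer_mul_totient_dvd {G V : Type*} [Group G] [Finite G]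
    [AddCommGroup V] [Module ℂ V] [FiniteDimensional ℂ V] (ρ : Representation ℂ G V)
    [IsIrreducible ρ] (hρ : Function.Injective ρ) {N : ℕ} [NeZero N] (hG : ∀ g : G, g ^ N = 1)
    [IsCyclic (Subgroup.center G)] :
    Nat.card (powStabilizer hG ρ.character) * (Nat.card (Subgroup.center G)).totient ∣
      N.totient := by
  obtain ⟨z, hz⟩ := IsCyclic.exists_ofOrder_eq_natCard (α := Subgroup.center G)
  have hdvd : Nat.card (Subgroup.center G) ∣ N := by
    rw [← hz]
    exact orderOf_dvd_of_pow_eq_one (Subtype.ext (hG z))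
  obtain ⟨c, hc⟩ := exists_eq_smul_one_of_commute ρ (ρ z) fun g v ↦ by
    rw [← Module.End.mul_apply, ← Module.End.mul_apply, ← map_mul, ← map_mul,
      Subgroup.mem_center_iff.1 z.2 g]
  have hnt := nontrivial_of_isIrreducible ρ
  have hle : powStabilizer hG ρ.character ≤ (ZMod.unitsMap hdvd).ker := by
    intro u hu
    have h1 : ρ.character ((z : G) ^ (u : ZMod N).val) = ρ.character z := congrFun hu z
    rw [character, character, map_pow, hc, smul_pow, one_pow, map_smul, map_smul,
      LinearMap.trace_one, smul_eq_mul, smul_eq_mul] at h1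
    have h2 : c ^ (u : ZMod N).val = c :=
      mul_right_cancel₀ (Nat.cast_ne_zero.2 finrank_pos.ne') h1
    have h3 : z ^ (u : ZMod N).val = z := by
      refine Subtype.ext (hρ ?_)
      rw [Subgroup.coe_pow, map_pow, hc, smul_pow, one_pow, h2]
    have h4 : (u : ZMod N).val ≡ 1 [MOD Nat.card (Subgroup.center G)] := by
      rw [← hz, ← pow_eq_pow_iff_modEq, pow_one, h3]
    rw [MonoidHom.mem_ker]
    ext
    rw [ZMod.unitsMap_val, Units.val_one, ← Nat.cast_one,
      ← (ZMod.natCast_eq_natCast_iff _ _ _).2 h4,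
      ZMod.natCast_val]
  have hcard : Nat.card (ZMod.unitsMap hdvd).ker * (Nat.card (Subgroup.center G)).totient =
      N.totient := by
    have : NeZero (Nat.card (Subgroup.center G)) := ⟨Nat.card_pos.ne'⟩
    rw [← ZMod.card_units_eq_totient, ← ZMod.card_units_eq_totient, ← Nat.card_eq_fintype_card,
      ← Nat.card_eq_fintype_card, ← Subgroup.card_mul_index (ZMod.unitsMap hdvd).ker,
      Subgroup.index_ker, MonoidHom.range_eq_top.2 (ZMod.unitsMap_surjective hdvd)]
    simp
  rw [← hcard]
  exact mul_dvd_mul_right (Subgroup.card_dvd_of_le hle) _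

theorem exists_injective_generalLinearGroup {G ι : Type*} [Group G] [Fintype ι] [DecidableEq ι]
    (M : G →* Matrix ι ι ℂ) (hM : Function.Injective M) {n : ℕ} (hn : Fintype.card ι = n) :
    ∃ ρ : G →* GL (Fin n) ℂ, Function.Injective ρ ∧
      ∀ g, (ρ g : Matrix (Fin n) (Fin n) ℂ).trace = (M g).trace := by
  let e : ι ≃ Fin n := Fintype.equivFinOfCardEq hn
  let r := Matrix.reindexAlgEquiv ℂ ℂ e
  let ρ : G →* GL (Fin n) ℂ := (r.toMulEquiv.toMonoidHom.comp M).toHomUnits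
  have hρ : ∀ g, (ρ g : Matrix (Fin n) (Fin n) ℂ) = r (M g) := fun _ ↦ rfl
  refine ⟨ρ, fun g h hgh ↦ hM (r.injective ?_), fun g ↦ ?_⟩
  · rw [← hρ, ← hρ, hgh]
  · rw [hρ, Matrix.trace, Matrix.trace]
    exact Fintype.sum_equiv e.symm _ _ fun i ↦ rfl

namespace Representation

section Orbit

variable {G V : Type*} [Group G] [AddCommGroup V] [Module ℂ V] [FiniteDimensional ℂ V]
  {N : ℕ} [NeZero N]

theorem exists_map_character_of_mem_powOrbit (hG : ∀ g : G, g ^ N = 1) (ρ : Representation ℂ G V)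
    {f : G → ℂ} (hf : f ∈ powOrbit ρ.character N) :
    ∃ σ : ℂ →+* ℂ, ∀ g, σ (ρ.character g) = f g := by
  classical
  obtain ⟨u, -, rfl⟩ := Finset.mem_image.1 hf
  obtain ⟨σ, hσ⟩ := exists_ringEquiv_pow (NeZero.ne N) (ZMod.val_coe_unit_coprime u)
  refine ⟨σ, fun g ↦ ?_⟩
  have := map_trace_of_pow_eq_one (NeZero.ne N) (σ : ℂ →+* ℂ) hσ (ρ g)
    (by rw [← map_pow, hG, map_one])
  rw [← map_pow] at this
  exact this

theorem exists_of_mem_powOrbit (hG : ∀ g : G, g ^ N = 1) (ρ : Representation ℂ G V)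
    {f : G → ℂ} (hf : f ∈ powOrbit ρ.character N) :
    ∃ R : Representation ℂ G (Fin (finrank ℂ V) → ℂ),
      R.character = f ∧ ∀ g, R g = 1 → ρ g = 1 := by
  obtain ⟨σ, hσ⟩ := exists_map_character_of_mem_powOrbit hG ρ hf
  obtain ⟨R, hR, hR'⟩ := exists_character_eq_map ρ σ
  exact ⟨R, funext fun g ↦ (hR g).trans (hσ g), hR'⟩

theorem sum_powOrbit_apply {p b q : ℕ} (hp : p.Prime) (hN : N = p ^ (b + 1))
    (hG : ∀ g : G, g ^ N = 1) (ρ : Representation ℂ G V)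
    (hq : Nat.card (powStabilizer hG ρ.character) * q = p ^ b) (g : G) :
    ∃ t : ℕ, ∑ f ∈ powOrbit ρ.character N, f g + (q * finrank ℂ V : ℕ) = (q * t : ℕ) := by
  subst hN
  obtain ⟨t, ht⟩ := exists_sum_trace_pow_add_eq hp (ρ g) (by rw [← map_pow, hG, map_one])
  refine ⟨t, ?_⟩
  have hs := sum_powConj hG ρ.character fun f ↦ f g
  have h0 : (Nat.card (powStabilizer hG ρ.character) : ℂ) ≠ 0 := by
    intro h
    rw [Nat.cast_eq_zero] at h
    rw [h, zero_mul] at hq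
    exact pow_ne_zero _ hp.ne_zero hq.symm
  refine mul_left_cancel₀ h0 ?_
  rw [mul_add, ← nsmul_eq_mul, ← hs]
  rw [← hq] at ht
  push_cast at ht ⊢
  rw [← mul_assoc, ← mul_assoc, ← ht]
  congr 1
  refine Finset.sum_congr rfl fun u _ ↦ ?_
  rw [← map_pow]
  rfl

/-- The sum of the Galois conjugates of `ρ` and of a trivial representation is quasi-permutation. -/
theorem exists_quasiPermutation {p b q : ℕ} (hp : p.Prime) (hN : N = p ^ (b + 1))
    (hG : ∀ g : G, g ^ N = 1) (ρ : Representation ℂ G V) (hρ : Function.Injective ρ)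
    (hq : Nat.card (powStabilizer hG ρ.character) * q = p ^ b) :
    ∃ θ : G →* GL (Fin (((powOrbit ρ.character N).card + q) * finrank ℂ V)) ℂ,
      Function.Injective θ ∧ ∀ g, ∃ m : ℕ, (θ g).val.trace = m := by
  classical
  choose R hR hR' using fun f : powOrbit ρ.character N ↦ exists_of_mem_powOrbit hG ρ f.2
  let M : G →* Matrix (Fin (finrank ℂ V) × powOrbit ρ.character N ⊕ Fin (q * finrank ℂ V))
      (Fin (finrank ℂ V) × powOrbit ρ.character N ⊕ Fin (q * finrank ℂ V)) ℂ :=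
    { toFun := fun g ↦ Matrix.fromBlocks
        (Matrix.blockDiagonal fun f ↦ LinearMap.toMatrix' (R f g)) 0 0 1
      map_one' := by
        simp only [map_one, LinearMap.toMatrix'_one]
        rw [← Pi.one_def, Matrix.blockDiagonal_one, Matrix.fromBlocks_one]
      map_mul' := fun g h ↦ by
        simp only [map_mul, LinearMap.toMatrix'_mul]
        rw [Matrix.blockDiagonal_mul, Matrix.fromBlocks_multiply]
        simp }
  have hM : Function.Injective M := by
    refine (injective_iff_map_eq_one M).2 fun g hg ↦ ?_
    let f : powOrbit ρ.character N := ⟨ρ.character, self_mem_powOrbit hG _⟩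
    have h1 : Matrix.blockDiagonal (fun f ↦ LinearMap.toMatrix' (R f g)) = 1 :=
      (Matrix.fromBlocks_inj.1 (hg.trans Matrix.fromBlocks_one.symm)).1
    have h2 := Matrix.blockDiagonal_injective (h1.trans Matrix.blockDiagonal_one.symm)
    have h3 : R f g = 1 :=
      LinearMap.toMatrix'.injective ((congrFun h2 f).trans LinearMap.toMatrix'_one.symm)
    exact hρ ((hR' f g h3).trans (map_one ρ).symm)
  obtain ⟨θ, hθ, hθ'⟩ := exists_injective_generalLinearGroup M hM
    (n := ((powOrbit ρ.character N).card + q) * finrank ℂ V) (by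
      rw [Fintype.card_sum, Fintype.card_prod, Fintype.card_fin, Fintype.card_coe, Fintype.card_fin]
      ring)
  refine ⟨θ, hθ, fun g ↦ ?_⟩
  obtain ⟨t, ht⟩ := sum_powOrbit_apply hp hN hG ρ hq g
  refine ⟨q * t, ?_⟩
  rw [← ht, hθ']
  have htr : (M g).trace = (Matrix.blockDiagonal fun f ↦ LinearMap.toMatrix' (R f g)).trace +
      (1 : Matrix (Fin (q * finrank ℂ V)) (Fin (q * finrank ℂ V)) ℂ).trace := by
    simp only [M, MonoidHom.coe_mk, OneHom.coe_mk]
    rw [Matrix.trace, Fintype.sum_sum_type]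
    rfl
  rw [htr, Matrix.trace_blockDiagonal, Matrix.trace_one, Fintype.card_fin]
  congr 1
  rw [← Finset.sum_coe_sort (powOrbit ρ.character N)]
  refine Finset.sum_congr rfl fun f _ ↦ ?_
  rw [← hR f, character, ← Matrix.trace_toLin'_eq, Matrix.toLin'_toMatrix']

end Orbit

section LowerBound

variable {G V W : Type*} [Group G] [AddCommGroup V] [Module ℂ V] [FiniteDimensional ℂ V]
  [AddCommGroup W] [Module ℂ W] [FiniteDimensional ℂ W]

theorem finrank_le_mul_finrank_range_sum_pow (θ : Representation ℂ G W)
    (hθ : ∀ g, ∃ m : ℕ, θ.character g = m) {p : ℕ} (hp : p ≠ 0) {z : G} (hz : z ^ p = 1) :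
    finrank ℂ W ≤ p * finrank ℂ (LinearMap.range (∑ i ∈ Finset.range p, θ z ^ i)) := by
  set E : End ℂ W := ∑ i ∈ Finset.range p, θ z ^ i with hE
  have hp' : (p : ℂ) ≠ 0 := Nat.cast_ne_zero.2 hp
  have hz' : θ z ^ p = 1 := by rw [← map_pow, hz, map_one]
  have h1 : θ z * E = E := by
    have := mul_geom_sum (θ z) p
    rw [hz', sub_self, sub_mul, one_mul, sub_eq_zero] at this
    exact this
  have h2 : ∀ i, θ z ^ i * E = E := fun i ↦ by
    induction i with
    | zero => rw [pow_zero, one_mul]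
    | succ i ih => rw [pow_succ, mul_assoc, h1, ih]
  have h3 : E * E = (p : ℂ) • E := by
    rw [hE, Finset.sum_mul, ← hE]
    simp_rw [h2]
    rw [Finset.sum_const, Finset.card_range, Nat.cast_smul_eq_nsmul]
  have hproj : LinearMap.IsProj (LinearMap.range E) ((p : ℂ)⁻¹ • E) := by
    constructor
    · intro x
      exact Submodule.smul_mem _ _ (LinearMap.mem_range_self E x)
    · rintro _ ⟨x, rfl⟩
      rw [LinearMap.smul_apply, ← Module.End.mul_apply, h3, LinearMap.smul_apply, smul_smul,
        inv_mul_cancel₀ hp', one_smul]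
  have htr := hproj.trace
  rw [map_smul, smul_eq_mul, inv_mul_eq_iff_eq_mul₀ hp', hE, map_sum] at htr
  simp_rw [← map_pow] at htr
  choose m hm using hθ
  have htr' : ∑ i ∈ Finset.range p, m (z ^ i) = p * finrank ℂ (LinearMap.range E) := by
    have : ∑ i ∈ Finset.range p, (m (z ^ i) : ℂ) = p * finrank ℂ (LinearMap.range E) := by
      rw [← htr]
      exact Finset.sum_congr rfl fun i _ ↦ (hm _).symm
    exact_mod_cast this
  rw [← htr']
  have hm1 : m (z ^ 0) = finrank ℂ W := by
    have := hm 1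
    rw [char_one] at this
    rw [pow_zero]
    exact_mod_cast this.symm
  rw [← hm1]
  exact Finset.single_le_sum (f := fun i ↦ m (z ^ i)) (fun _ _ ↦ Nat.zero_le _)
    (Finset.mem_range.2 (Nat.pos_of_ne_zero hp))

theorem sum_pow_eq_zero_of_isIrreducible (R : Representation ℂ G V) [IsIrreducible R] {p : ℕ}
    {z : G} (hz : z ^ p = 1) (hzc : z ∈ Subgroup.center G) (hR : R z ≠ 1) :
    ∑ i ∈ Finset.range p, R z ^ i = 0 := by
  obtain ⟨c, hc⟩ := exists_eq_smul_one_of_commute R (R z) fun g v ↦ by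
    rw [← Module.End.mul_apply, ← Module.End.mul_apply, ← map_mul, ← map_mul,
      Subgroup.mem_center_iff.1 hzc g]
  have hnt := nontrivial_of_isIrreducible R
  have hc1 : c ≠ 1 := by
    rintro rfl
    exact hR (by rw [hc, one_smul])
  have hcp : c ^ p = 1 := by
    have : R z ^ p = 1 := by rw [← map_pow, hz, map_one]
    rw [hc, smul_pow, one_pow] at this
    obtain ⟨v, hv⟩ := exists_ne (0 : V)
    have h2 : (c ^ p - 1) • v = 0 := by
      rw [sub_smul, one_smul, sub_eq_zero]
      exact congrArg (fun T : End ℂ V ↦ T v) this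
    exact sub_eq_zero.1 ((smul_eq_zero.1 h2).resolve_right hv)
  simp_rw [hc, smul_pow, one_pow]
  rw [← Finset.sum_smul, geom_sum_eq_ite hcp, if_neg hc1, zero_smul]

variable [Fintype G]

theorem card_powOrbit_mul_finrank_le {N : ℕ} [NeZero N] (hG : ∀ g : G, g ^ N = 1)
    (ρ : Representation ℂ G V) [IsIrreducible ρ] (θ : Representation ℂ G W)
    (hθ : ∀ g, ∃ m : ℕ, θ.character g = m) (T : IntertwiningMap ρ θ) (hT : T ≠ 0)
    {p : ℕ} {z : G} (hz : z ^ p = 1) (hzc : z ∈ Subgroup.center G) (hρz : ρ z ≠ 1) :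
    (powOrbit ρ.character N).card * finrank ℂ V ≤
      finrank ℂ (LinearMap.ker (∑ i ∈ Finset.range p, θ z ^ i)) := by
  classical
  set E : End ℂ W := ∑ i ∈ Finset.range p, θ z ^ i with hE
  choose R hR hR' using fun f : powOrbit ρ.character N ↦ exists_of_mem_powOrbit hG ρ f.2
  choose σ hσ using fun f : powOrbit ρ.character N ↦
    exists_map_character_of_mem_powOrbit hG ρ f.2
  have hirr : ∀ f, IsIrreducible (R f) := fun f ↦
    isIrreducible_of_character_eq_map (ρ := ρ) (σ := σ f) fun g ↦ by rw [hR, hσ]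
  have hHom : ∀ f, ∃ S : IntertwiningMap (R f) θ, Function.Injective S := by
    intro f
    have h1 := sum_character_mul_character_inv_eq_finrank ρ θ
    have h2 := sum_character_mul_character_inv_eq_finrank (R f) θ
    have h3 := congrArg (σ f) h1
    rw [map_sum, map_mul, map_natCast, map_natCast] at h3
    have h4 : ∀ g, σ f (θ.character g * ρ.character g⁻¹) =
        θ.character g * (R f).character g⁻¹ := by
      intro g
      obtain ⟨m, hm⟩ := hθ g
      rw [map_mul, hm, map_natCast, hσ, hR]
    simp_rw [h4] at h3
    have h5 : finrank ℂ (IntertwiningMap (R f) θ) = finrank ℂ (IntertwiningMap ρ θ) := by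
      exact_mod_cast mul_left_cancel₀ (NeZero.ne (Nat.card G : ℂ)) (h2.symm.trans h3)
    have h6 : 0 < finrank ℂ (IntertwiningMap (R f) θ) := by
      rw [h5, finrank_pos_iff_exists_ne_zero]
      exact ⟨T, hT⟩
    obtain ⟨S, hS⟩ := finrank_pos_iff_exists_ne_zero.1 h6
    exact ⟨S, (IsIrreducible.injective_or_eq_zero S).resolve_right hS⟩
  choose S hS using hHom
  have hSE : ∀ f v, E (S f v) = 0 := by
    intro f v
    have h0 := sum_pow_eq_zero_of_isIrreducible (R f) hz hzc fun h ↦ hρz (hR' f z h)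
    have h1 : E (S f v) = S f ((∑ i ∈ Finset.range p, R f z ^ i) v) := by
      simp only [hE, LinearMap.sum_apply, map_sum, ← map_pow, IntertwiningMap.isIntertwining]
    rw [h1, h0, LinearMap.zero_apply, map_zero]
  let Φ : (powOrbit ρ.character N → Fin (finrank ℂ V) → ℂ) →ₗ[ℂ] W :=
    ∑ f, (S f).toLinearMap ∘ₗ LinearMap.proj f
  have hΦ : ∀ x, Φ x = ∑ f, S f (x f) := fun x ↦ by
    simp [Φ, LinearMap.sum_apply]
  have hinj : Function.Injective Φ := by
    refine (injective_iff_map_eq_zero Φ).2 fun x hx ↦ funext fun f ↦ ?_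
    choose c hc hcd using fun f' ↦ exists_sum_character_inv_smul_eq (R f) (R f')
    have h1 : ∀ f' v, (∑ g, (R f).character g⁻¹ • θ g) (S f' v) = c f' • S f' v := by
      intro f' v
      have := congrArg (fun A : End ℂ (Fin (finrank ℂ V) → ℂ) ↦ S f' (A v)) (hc f')
      simp only [LinearMap.sum_apply, map_sum, LinearMap.smul_apply, map_smul,
        IntertwiningMap.isIntertwining, Module.End.one_apply] at this
      simpa only [LinearMap.sum_apply, LinearMap.smul_apply] using this
    have hnt := nontrivial_of_isIrreducible ρ
    have hd : (finrank ℂ (Fin (finrank ℂ V) → ℂ) : ℂ) ≠ 0 := by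
      rw [finrank_fin_fun]
      exact Nat.cast_ne_zero.2 finrank_pos.ne'
    have hc0 : ∀ f' ≠ f, c f' = 0 := by
      intro f' hf'
      have h2 := hcd f'
      rw [sum_character_mul_character_inv_of_ne (R f) (R f')
        (by rw [hR, hR]; exact fun h ↦ hf' (Subtype.ext h.symm))] at h2
      exact (mul_eq_zero.1 h2).resolve_right hd
    have hcf : c f ≠ 0 := by
      intro h
      have h2 := hcd f
      rw [sum_character_mul_character_inv_self, h, zero_mul] at h2
      exact NeZero.ne (Nat.card G : ℂ) h2.symm
    have h3 := congrArg (fun w ↦ (∑ g, (R f).character g⁻¹ • θ g : End ℂ W) w) hx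
    rw [hΦ, map_sum, map_zero, Finset.sum_congr rfl fun f' _ ↦ h1 f' (x f'),
      Finset.sum_eq_single f (fun f' _ hf' ↦ by rw [hc0 f' hf', zero_smul])
        (fun h ↦ (h (Finset.mem_univ _)).elim)] at h3
    exact hS f (((smul_eq_zero.1 h3).resolve_left hcf).trans (map_zero (S f)).symm)
  have hker : ∀ x, Φ x ∈ LinearMap.ker E := fun x ↦ by
    rw [LinearMap.mem_ker, hΦ, map_sum]
    exact Finset.sum_eq_zero fun f _ ↦ hSE f (x f)
  have hle := LinearMap.finrank_le_finrank_of_injective (f := Φ.codRestrict _ hker)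
    (fun x y h ↦ hinj (congrArg Subtype.val h))
  rwa [finrank_pi_fintype, Finset.sum_const, Finset.card_univ, Fintype.card_coe, finrank_fin_fun,
    smul_eq_mul] at hle

end LowerBound

section Constituent

variable {G W : Type*} [Group G] [AddCommGroup W] [Module ℂ W]

theorem isIrreducible_of_isAtom {θ : Representation ℂ G W} {S : Subrepresentation θ}
    (hS : IsAtom S) : IsIrreducible S.toRepresentation := by
  have hmap (T : Subrepresentation S.toRepresentation) : T = ⊥ ∨ T = ⊤ := by
    let T' : Subrepresentation θ :=
      ⟨T.toSubmodule.map S.toSubmodule.subtype, by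
        rintro g _ ⟨v, hv, rfl⟩
        exact ⟨S.toRepresentation g v, T.apply_mem_toSubmodule g hv, rfl⟩⟩
    have hle : T' ≤ S := by
      rintro _ ⟨v, -, rfl⟩
      exact v.2
    rcases hS.le_iff.1 hle with h | h
    · left
      apply Subrepresentation.toSubmodule_injective
      have : T.toSubmodule.map S.toSubmodule.subtype = ⊥ :=
        congrArg Subrepresentation.toSubmodule h
      exact Submodule.map_injective_of_injective S.toSubmodule.injective_subtype
        (this.trans (Submodule.map_bot _).symm)
    · right
      apply Subrepresentation.toSubmodule_injective
      have : T.toSubmodule.map S.toSubmodule.subtype = S.toSubmodule :=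
        congrArg Subrepresentation.toSubmodule h
      exact Submodule.map_injective_of_injective S.toSubmodule.injective_subtype
        (this.trans S.toSubmodule.map_subtype_top.symm)
  have : Nontrivial (Subrepresentation S.toRepresentation) := by
    refine ⟨⊥, ⊤, fun h => hS.1 ?_⟩
    apply Subrepresentation.toSubmodule_injective
    have h' : (⊥ : Submodule ℂ S.toSubmodule) = ⊤ := congrArg Subrepresentation.toSubmodule h
    have := congrArg (Submodule.map S.toSubmodule.subtype) h'
    rw [Submodule.map_bot, Submodule.map_subtype_top] at this
    exact this.symm
  exact { eq_bot_or_eq_top := hmap }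

theorem exists_isIrreducible_le [FiniteDimensional ℂ W] {θ : Representation ℂ G W}
    {U : Subrepresentation θ} (hU : U ≠ ⊥) :
    ∃ S ≤ U, IsIrreducible S.toRepresentation := by
  have : WellFoundedLT (Subrepresentation θ) :=
    StrictMono.wellFoundedLT (f := Subrepresentation.toSubmodule) fun _ _ h => h
  have : IsAtomic (Subrepresentation θ) := isAtomic_of_orderBot_wellFounded_lt wellFounded_lt
  obtain ⟨S, hS, hle⟩ := (eq_bot_or_exists_atom_le U).resolve_left hU
  exact ⟨S, hle, isIrreducible_of_isAtom hS⟩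

/-- A subrepresentation on which a central element of order `p` has no fixed vector. -/
theorem exists_isIrreducible_apply_ne_one [FiniteDimensional ℂ W] (θ : Representation ℂ G W)
    {z : G} {p : ℕ} (hp : p ≠ 0) (hz : z ^ p = 1) (hzc : z ∈ Subgroup.center G)
    (hθ : θ z ≠ 1) :
    ∃ S : Subrepresentation θ, IsIrreducible S.toRepresentation ∧ S.toRepresentation z ≠ 1 := by
  have hzp : θ z ^ p = 1 := by rw [← map_pow, hz, map_one]
  let U : Subrepresentation θ := ⟨LinearMap.ker (∑ i ∈ Finset.range p, θ z ^ i), by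
    intro g v hv
    rw [LinearMap.mem_ker] at hv ⊢
    have hcomm : Commute (∑ i ∈ Finset.range p, θ z ^ i) (θ g) := by
      refine Commute.sum_left _ _ _ fun i _ => Commute.pow_left ?_ i
      rw [Commute, SemiconjBy, ← map_mul, ← map_mul, Subgroup.mem_center_iff.1 hzc g]
    have := LinearMap.congr_fun hcomm.eq v
    simp only [Module.End.mul_apply, hv, map_zero] at this
    exact this⟩
  have hU : U ≠ ⊥ := by
    intro h
    apply hθ
    have h' : LinearMap.ker (∑ i ∈ Finset.range p, θ z ^ i) = ⊥ :=
      congrArg Subrepresentation.toSubmodule h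
    ext v
    have hv : (θ z - 1) v ∈ LinearMap.ker (∑ i ∈ Finset.range p, θ z ^ i) := by
      rw [LinearMap.mem_ker, ← Module.End.mul_apply, geom_sum_mul, hzp, sub_self,
        LinearMap.zero_apply]
    rw [h', Submodule.mem_bot] at hv
    simpa [sub_eq_zero] using hv
  obtain ⟨S, hSU, hS⟩ := exists_isIrreducible_le hU
  refine ⟨S, hS, fun h1 => ?_⟩
  have := nontrivial_of_isIrreducible S.toRepresentation
  obtain ⟨v, hv⟩ := exists_ne (0 : S.toSubmodule)
  have hzv : θ z (v : W) = v := congrArg Subtype.val (LinearMap.congr_fun h1 v)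
  have hpow (i : ℕ) : (θ z ^ i) (v : W) = v := by
    induction i with
    | zero => simp
    | succ i ih => rw [pow_succ, Module.End.mul_apply, hzv, ih]
  have hvU : (v : W) ∈ LinearMap.ker (∑ i ∈ Finset.range p, θ z ^ i) := hSU v.2
  rw [LinearMap.mem_ker, LinearMap.sum_apply] at hvU
  simp only [hpow, Finset.sum_const, Finset.card_range] at hvU
  rw [← Nat.cast_smul_eq_nsmul ℂ, smul_eq_zero, Nat.cast_eq_zero] at hvU
  exact hv (Subtype.ext (hvU.resolve_left hp))

end Constituent

end Representation

section PGroup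

variable {G : Type*} [Group G] [Finite G] {p : ℕ} [Fact p.Prime]

theorem IsPGroup.exists_mem_center_orderOf_eq (hG : IsPGroup p G) {N : Subgroup G} [N.Normal]
    (hN : N ≠ ⊥) : ∃ w ∈ N, w ∈ Subgroup.center G ∧ orderOf w = p := by
  have hne : Nontrivial N := (Subgroup.nontrivial_iff_ne_bot N).2 hN
  have hdvd : p ∣ Nat.card N := by
    obtain ⟨n, hn0, hn⟩ := (hG.to_subgroup N).nontrivial_iff_card.mp hne
    exact hn.symm ▸ dvd_pow_self _ hn0.ne'
  have hG' := hG.of_equiv ConjAct.toConjAct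
  obtain ⟨b, hb, hb1⟩ := hG'.exists_fixed_point_of_prime_dvd_card_of_fixed_point
    N hdvd (a := 1) (fun g => smul_one g)
  have hbc : (b : G) ∈ Subgroup.center G := by
    rw [Subgroup.mem_center_iff]
    intro g
    have := congrArg Subtype.val (hb (ConjAct.toConjAct g))
    rw [ConjAct.Subgroup.val_conj_smul, ConjAct.toConjAct_smul] at this
    exact mul_inv_eq_iff_eq_mul.1 this
  have hNc : Nontrivial (N ⊓ Subgroup.center G : Subgroup G) := by
    refine ⟨⟨b, b.2, hbc⟩, 1, fun h => hb1 ?_⟩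
    exact Subtype.ext (congrArg Subtype.val h).symm
  have hdvd' : p ∣ Nat.card (N ⊓ Subgroup.center G : Subgroup G) := by
    obtain ⟨n, hn0, hn⟩ := (hG.to_subgroup (N ⊓ Subgroup.center G)).nontrivial_iff_card.mp hNc
    exact hn.symm ▸ dvd_pow_self _ hn0.ne'
  obtain ⟨w, hw⟩ := exists_prime_orderOf_dvd_card' p hdvd'
  exact ⟨w, w.2.1, w.2.2, by rw [Subgroup.orderOf_coe, hw]⟩

omit [Fact p.Prime] in
theorem mem_zpowers_of_mem_center_of_orderOf_eq [IsCyclic (Subgroup.center G)] {w z : G}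
    (hw : w ∈ Subgroup.center G) (hz : z ∈ Subgroup.center G) (hwp : orderOf w = p)
    (hp : p ≠ 0) (hzp : z ^ p = 1) : z ∈ Subgroup.zpowers w := by
  classical
  have := Fintype.ofFinite (Subgroup.center G)
  let w' : Subgroup.center G := ⟨w, hw⟩
  have hw' : orderOf w' = p := by rw [← hwp]; exact (Subgroup.orderOf_coe w').symm
  let S : Finset (Subgroup.center G) := Finset.univ.filter fun x => x ^ p = 1
  have hS : S.card ≤ p := IsCyclic.card_pow_eq_one_le (Nat.pos_of_ne_zero hp)
  have hsub : (Subgroup.zpowers w' : Set (Subgroup.center G)).toFinset ⊆ S := by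
    intro x hx
    rw [Set.mem_toFinset] at hx
    obtain ⟨k, rfl⟩ := hx
    simp only [S, Finset.mem_filter, Finset.mem_univ, true_and]
    rw [← zpow_natCast, ← zpow_mul, mul_comm, zpow_mul, zpow_natCast, ← hw', pow_orderOf_eq_one,
      one_zpow]
  have hcard : (Subgroup.zpowers w' : Set (Subgroup.center G)).toFinset.card = p := by
    rw [Set.toFinset_card, ← Nat.card_eq_fintype_card, ← hw']
    exact Nat.card_zpowers w'
  have heq := Finset.eq_of_subset_of_card_le hsub (hS.trans hcard.ge)
  have hzS : (⟨z, hz⟩ : Subgroup.center G) ∈ S := by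
    simp only [S, Finset.mem_filter, Finset.mem_univ, true_and]
    exact Subtype.ext hzp
  rw [← heq, Set.mem_toFinset] at hzS
  obtain ⟨k, hk⟩ := hzS
  exact ⟨k, congrArg Subtype.val hk⟩

end PGroup

namespace Representation

theorem injective_of_apply_ne_one {G V : Type*} [Group G] [Finite G] [AddCommGroup V] [Module ℂ V]
    {p : ℕ} [Fact p.Prime] (hG : IsPGroup p G) [IsCyclic (Subgroup.center G)]
    (ρ : Representation ℂ G V) {z : G} (hz : z ^ p = 1) (hzc : z ∈ Subgroup.center G)
    (hρz : ρ z ≠ 1) : Function.Injective ρ := by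
  rw [← MonoidHom.ker_eq_bot_iff]
  by_contra hker
  obtain ⟨w, hwk, hwc, hw⟩ := hG.exists_mem_center_orderOf_eq hker
  have := mem_zpowers_of_mem_center_of_orderOf_eq hwc hzc hw (Fact.out : p.Prime).ne_zero hz
  exact hρz (MonoidHom.mem_ker.1 ((Subgroup.zpowers_le.2 hwk) this))

/-- A faithful representation of a `p`-group with cyclic center has a faithful constituent. -/
theorem exists_isIrreducible_injective {G W : Type*} [Group G] [Finite G] [Nontrivial G]
    [AddCommGroup W] [Module ℂ W] [FiniteDimensional ℂ W] {p : ℕ} [Fact p.Prime]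
    (hG : IsPGroup p G) [IsCyclic (Subgroup.center G)] (θ : Representation ℂ G W)
    (hθ : Function.Injective θ) :
    ∃ S : Subrepresentation θ, IsIrreducible S.toRepresentation ∧
      Function.Injective S.toRepresentation ∧
      ∃ z ∈ Subgroup.center G, z ^ p = 1 ∧ S.toRepresentation z ≠ 1 := by
  obtain ⟨z, -, hzc, hz⟩ := hG.exists_mem_center_orderOf_eq (N := ⊤) top_ne_bot
  have hzp : z ^ p = 1 := hz ▸ pow_orderOf_eq_one z
  have hp : p.Prime := Fact.out
  have hz1 : z ≠ 1 := by
    rintro rfl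
    rw [orderOf_one] at hz
    exact hp.one_lt.ne hz
  obtain ⟨S, hS, hSz⟩ := exists_isIrreducible_apply_ne_one θ hp.ne_zero hzp hzc
    fun h => hz1 (hθ (h.trans (map_one θ).symm))
  exact ⟨S, hS, injective_of_apply_ne_one hG _ hzp hzc hSz, z, hzc, hzp, hSz⟩

section Degree

variable {G : Type*} [Group G]

theorem exists_card_powOrbit_add_eq [Finite G] [IsCyclic (Subgroup.center G)]
    {V : Type*} [AddCommGroup V] [Module ℂ V]
    [FiniteDimensional ℂ V] (ρ : Representation ℂ G V) [IsIrreducible ρ]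
    (hρ : Function.Injective ρ) {p b k N : ℕ} [NeZero N] (hp : p.Prime) (hN : N = p ^ (b + 1))
    (hG : ∀ g : G, g ^ N = 1) (hZ : Nat.card (Subgroup.center G) = p ^ (k + 1)) :
    ∃ q : ℕ, Nat.card (powStabilizer hG ρ.character) * q = p ^ b ∧ p ^ k ∣ q ∧
      (powOrbit ρ.character N).card + q = p * q := by
  have hp1 : 0 < p - 1 := Nat.sub_pos_of_lt hp.one_lt
  have hdvd := card_powStabilizer_mul_totient_dvd ρ hρ hG
  set h := Nat.card (powStabilizer hG ρ.character)
  have hh : 0 < h := Nat.card_pos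
  have hφ : N.totient = p ^ b * (p - 1) := by rw [hN, Nat.totient_prime_pow_succ hp]
  rw [hZ, Nat.totient_prime_pow_succ hp, hφ, ← mul_assoc] at hdvd
  obtain ⟨r, hr⟩ := Nat.dvd_of_mul_dvd_mul_right hp1 hdvd
  have hq : h * (p ^ k * r) = p ^ b := by rw [hr, mul_assoc]
  refine ⟨p ^ k * r, hq, dvd_mul_right _ _, ?_⟩
  have horb := sum_powConj hG ρ.character (fun _ => (1 : ℕ))
  rw [Finset.sum_const, Finset.sum_const, Finset.card_univ, ZMod.card_units_eq_totient, hφ,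
    smul_eq_mul, smul_eq_mul, smul_eq_mul, mul_one, mul_one, ← hq, mul_assoc] at horb
  rw [← Nat.eq_of_mul_eq_mul_left hh horb, ← Nat.mul_succ, Nat.succ_eq_add_one,
    Nat.sub_add_cancel hp.one_le, mul_comm]

theorem quasiPermDegree_le {V : Type*} [AddCommGroup V] [Module ℂ V]
    [FiniteDimensional ℂ V] (ρ : Representation ℂ G V)
    (hρ : Function.Injective ρ) {p b q N : ℕ} [NeZero N] (hp : p.Prime) (hN : N = p ^ (b + 1))
    (hG : ∀ g : G, g ^ N = 1) (hq : Nat.card (powStabilizer hG ρ.character) * q = p ^ b) :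
    quasiPermDegree G ≤ ((powOrbit ρ.character N).card + q) * finrank ℂ V :=
  Nat.sInf_le (exists_quasiPermutation hp hN hG ρ hρ hq)

theorem exists_representation_quasiPermDegree {m : ℕ} (h : ∃ τ : G →* GL (Fin m) ℂ,
      Function.Injective τ ∧ ∀ g, ∃ m : ℕ, (τ g).val.trace = m) :
    ∃ θ : Representation ℂ G (Fin (quasiPermDegree G) → ℂ), Function.Injective θ ∧
      ∀ g, ∃ m : ℕ, θ.character g = m := by
  obtain ⟨τ, hτ, htr⟩ := Nat.sInf_mem (s := {n | ∃ τ : G →* GL (Fin n) ℂ,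
      Function.Injective τ ∧ ∀ g, ∃ m : ℕ, (τ g).val.trace = m}) ⟨m, h⟩
  change G →* GL (Fin (quasiPermDegree G)) ℂ at τ
  let L : Matrix (Fin (quasiPermDegree G)) (Fin (quasiPermDegree G)) ℂ ≃ₐ[ℂ]
    End ℂ (Fin (quasiPermDegree G) → ℂ) := Matrix.toLinAlgEquiv'
  refine ⟨(L : _ →* _).comp ((Units.coeHom _).comp τ),
    L.injective.comp (Units.val_injective.comp hτ), fun g => ?_⟩
  obtain ⟨m, hm⟩ := htr g
  refine ⟨m, ?_⟩
  rw [← hm]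
  exact Matrix.trace_toLin'_eq _

theorem mul_finrank_le [Finite G] {V W : Type*} [AddCommGroup V] [Module ℂ V]
    [FiniteDimensional ℂ V] [AddCommGroup W] [Module ℂ W] [FiniteDimensional ℂ W] {N : ℕ} [NeZero N]
    (hG : ∀ g : G, g ^ N = 1) (ρ : Representation ℂ G V) [IsIrreducible ρ]
    (θ : Representation ℂ G W) (hθ : ∀ g, ∃ m : ℕ, θ.character g = m)
    (T : IntertwiningMap ρ θ) (hT : T ≠ 0) {p q : ℕ} (hp : p ≠ 0) {z : G} (hz : z ^ p = 1)
    (hzc : z ∈ Subgroup.center G) (hρz : ρ z ≠ 1)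
    (hq : (powOrbit ρ.character N).card + q = p * q) (hp1 : 1 < p) :
    p * q * finrank ℂ V ≤ finrank ℂ W := by
  have := Fintype.ofFinite G
  have h1 := finrank_le_mul_finrank_range_sum_pow θ hθ hp hz
  have h2 := card_powOrbit_mul_finrank_le hG ρ θ hθ T hT hz hzc hρz
  have h3 := LinearMap.finrank_range_add_finrank_ker (∑ i ∈ Finset.range p, θ z ^ i)
  obtain ⟨r, rfl⟩ : ∃ r, p = r + 2 := ⟨p - 2, by omega⟩
  have hO : (powOrbit ρ.character N).card = (r + 1) * q := by linarith
  rw [hO] at h2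
  set R := finrank ℂ (LinearMap.range (∑ i ∈ Finset.range (r + 2), θ z ^ i))
  set K := finrank ℂ (LinearMap.ker (∑ i ∈ Finset.range (r + 2), θ z ^ i))
  rw [← h3] at h1 ⊢
  have h4 : K ≤ (r + 1) * R := by linarith
  have h5 : q * finrank ℂ V ≤ R := by
    refine Nat.le_of_mul_le_mul_left (?_ : (r + 1) * _ ≤ (r + 1) * _) (Nat.succ_pos r)
    rw [← mul_assoc]
    exact h2.trans h4
  linarith

/-- The minimal degree is governed by the faithful irreducible characters. -/
theorem exists_quasiPermDegree_eq [Finite G] [Nontrivial G] [IsCyclic (Subgroup.center G)]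
    {U : Type*} [AddCommGroup U] [Module ℂ U]
    [FiniteDimensional ℂ U] (σ : Representation ℂ G U) [IsIrreducible σ]
    (hσ : Function.Injective σ) {p b k : ℕ} (hp : p.Prime) (hpG : IsPGroup p G)
    (hG : ∀ g : G, g ^ p ^ (b + 1) = 1) (hZ : Nat.card (Subgroup.center G) = p ^ (k + 1)) :
    ∃ (n : ℕ) (S : Submodule ℂ (Fin n → ℂ)) (ρ : Representation ℂ G S) (q : ℕ),
      IsIrreducible ρ ∧ Function.Injective ρ ∧ p ^ k ∣ q ∧ q ∣ p ^ b ∧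
        quasiPermDegree G = p * q * finrank ℂ S := by
  have : Fact p.Prime := ⟨hp⟩
  have : NeZero (p ^ (b + 1)) := ⟨pow_ne_zero _ hp.ne_zero⟩
  obtain ⟨q₀, hq₀, -, -⟩ := exists_card_powOrbit_add_eq σ hσ hp rfl hG hZ
  obtain ⟨θ, hθ, htr⟩ :=
    exists_representation_quasiPermDegree (exists_quasiPermutation hp rfl hG σ hσ hq₀)
  obtain ⟨S, hS, hSi, z, hzc, hz, hSz⟩ := exists_isIrreducible_injective hpG θ hθ
  obtain ⟨q, hq, hkq, hO⟩ := exists_card_powOrbit_add_eq S.toRepresentation hSi hp rfl hG hZ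
  refine ⟨_, S.toSubmodule, S.toRepresentation, q, hS, hSi, hkq, ⟨_, by rw [mul_comm, hq]⟩, ?_⟩
  apply le_antisymm
  · rw [← hO]
    exact quasiPermDegree_le _ hSi hp rfl hG hq
  · let T : IntertwiningMap S.toRepresentation θ :=
      ⟨S.toSubmodule.subtype, fun g => rfl⟩
    have hT : T ≠ 0 := by
      intro h
      have := nontrivial_of_isIrreducible S.toRepresentation
      obtain ⟨v, hv⟩ := exists_ne (0 : S.toSubmodule)
      exact hv (Subtype.ext (congrArg (fun f : IntertwiningMap S.toRepresentation θ => f v) h))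
    simpa using mul_finrank_le hG S.toRepresentation θ htr T hT hp.ne_zero hz hzc hSz hO hp.one_lt

end Degree

end Representation

theorem commute_of_commute_of_basis {ι K V : Type*} [Field K] [AddCommGroup V] [Module K V]
    (B : Basis ι K V) {f g h : End K V} {μ : ι → K} (hμ : Function.Injective μ)
    (hf : ∀ i, f (B i) = μ i • B i) (hg : Commute g f) (hh : Commute h f) : Commute g h := by
  have key {g : End K V} (hg : Commute g f) (i : ι) : g (B i) = B.repr (g (B i)) i • B i := by
    have hfB (v : V) (j : ι) : B.repr (f v) j = μ j * B.repr v j := by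
      have : (B.coord j) ∘ₗ f = μ j • B.coord j := B.ext fun k => by
        simp only [LinearMap.comp_apply, hf, map_smul, LinearMap.smul_apply, Basis.coord_apply,
          Basis.repr_self, smul_eq_mul]
        by_cases hjk : k = j
        · rw [hjk]
        · simp [Finsupp.single_eq_of_ne' hjk]
      exact LinearMap.congr_fun this v
    apply B.ext_elem
    intro j
    rw [map_smul, Finsupp.smul_apply, B.repr_self, smul_eq_mul]
    by_cases hij : i = j
    · rw [hij, Finsupp.single_eq_same, mul_one]
    · have h1 : f (g (B i)) = μ i • g (B i) := by
        rw [← Module.End.mul_apply, ← hg.eq, Module.End.mul_apply, hf, map_smul]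
      have h2 := hfB (g (B i)) j
      rw [h1, map_smul, Finsupp.smul_apply, smul_eq_mul] at h2
      have h3 : μ i - μ j ≠ 0 := sub_ne_zero.2 fun h => hij (hμ h)
      have h4 : (μ i - μ j) * B.repr (g (B i)) j = 0 := by linear_combination h2
      rw [Finsupp.single_eq_of_ne' hij, mul_zero]
      exact (mul_eq_zero.1 h4).resolve_left h3
  refine B.ext fun i => ?_
  obtain ⟨c, hc⟩ : ∃ c : K, g (B i) = c • B i := ⟨_, key hg i⟩
  obtain ⟨d, hd⟩ : ∃ d : K, h (B i) = d • B i := ⟨_, key hh i⟩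
  rw [Module.End.mul_apply, Module.End.mul_apply, hc, hd, map_smul, map_smul, hc, hd, smul_comm]

theorem IsPGroup.exists_commutator_mem_center {G : Type*} [Group G] [Finite G] {p : ℕ}
    [Fact p.Prime] (hG : IsPGroup p G) (hZ : Subgroup.center G ≠ ⊤) :
    ∃ x ∉ Subgroup.center G, ∀ g : G, g * x * g⁻¹ * x⁻¹ ∈ Subgroup.center G := by
  have : Nontrivial (G ⧸ Subgroup.center G) := QuotientGroup.nontrivial_iff.2 hZ
  have := (hG.to_quotient (Subgroup.center G)).center_nontrivial
  obtain ⟨⟨y, hy⟩, hy1⟩ := exists_ne (1 : Subgroup.center (G ⧸ Subgroup.center G))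
  obtain ⟨x, rfl⟩ := QuotientGroup.mk_surjective y
  refine ⟨x, fun hx => hy1 (Subtype.ext ((QuotientGroup.eq_one_iff x).2 hx)), fun g => ?_⟩
  rw [← QuotientGroup.eq_one_iff]
  have := Subgroup.mem_center_iff.1 hy (g : G ⧸ Subgroup.center G)
  rw [QuotientGroup.mk_mul, QuotientGroup.mk_mul, QuotientGroup.mk_mul, this]
  simp

/-- The homomorphism `g ↦ ⁅g, x⁆` for `x` central modulo the center. -/
def commutatorCenterHom {G : Type*} [Group G] (x : G)
    (hx : ∀ g : G, g * x * g⁻¹ * x⁻¹ ∈ Subgroup.center G) : G →* Subgroup.center G where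
  toFun g := ⟨g * x * g⁻¹ * x⁻¹, hx g⟩
  map_one' := by simp
  map_mul' g h := by
    apply Subtype.ext
    have := Subgroup.mem_center_iff.1 (hx h) g
    calc g * h * x * (g * h)⁻¹ * x⁻¹ = g * (h * x * h⁻¹ * x⁻¹) * (x * g⁻¹ * x⁻¹) := by group
      _ = (h * x * h⁻¹ * x⁻¹) * (g * x * g⁻¹ * x⁻¹) := by rw [this]; group
      _ = (g * x * g⁻¹ * x⁻¹) * (h * x * h⁻¹ * x⁻¹) :=
        (Subgroup.mem_center_iff.1 (hx h) _).symm

namespace Representation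

/-- Irreducible degrees are bounded by the index of an abelian subgroup. -/
theorem finrank_le_index {G V : Type*} [Group G] [AddCommGroup V] [Module ℂ V]
    [FiniteDimensional ℂ V] (ρ : Representation ℂ G V) [IsIrreducible ρ] (A : Subgroup G)
    [IsMulCommutative A] [A.FiniteIndex] : finrank ℂ V ≤ A.index := by
  have := nontrivial_of_isIrreducible ρ
  let σ : Representation ℂ A V := ρ.comp A.subtype
  have htop : (⊤ : Subrepresentation σ) ≠ ⊥ := fun h => by
    have : (⊤ : Submodule ℂ V) = ⊥ := congrArg Subrepresentation.toSubmodule h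
    exact top_ne_bot this
  obtain ⟨S, -, hS⟩ := exists_isIrreducible_le htop
  have h1 : finrank ℂ S.toSubmodule = 1 :=
    IsIrreducible.finrank_eq_one_of_isMulCommutative S.toRepresentation
  obtain ⟨⟨w, hwS⟩, hw0, hw⟩ := finrank_eq_one_iff'.1 h1
  have hA (a : A) : ∃ c : ℂ, ρ a w = c • w := by
    obtain ⟨c, hc⟩ := hw (S.toRepresentation a ⟨w, hwS⟩)
    exact ⟨c, (congrArg Subtype.val hc).symm⟩
  have hw0 : w ≠ 0 := fun h => hw0 (Subtype.ext h)
  let v : G ⧸ A → V := fun q => ρ q.out w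
  have hv (g : G) : ρ g w ∈ Submodule.span ℂ (Set.range v) := by
    obtain ⟨a, ha⟩ := QuotientGroup.mk_out_eq_mul A g
    obtain ⟨c, hc⟩ := hA a⁻¹
    have : ρ g w = c • v g := by
      rw [← map_smul, ← hc, ha, ← Module.End.mul_apply, ← map_mul]
      simp
    rw [this]
    exact Submodule.smul_mem _ _ (Submodule.subset_span ⟨_, rfl⟩)
  let M : Subrepresentation ρ := ⟨Submodule.span ℂ (Set.range v), fun g u hu => by
    refine (Submodule.span_le (p := (Submodule.span ℂ (Set.range v)).comap (ρ g))).2 ?_ hu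
    rintro _ ⟨q, rfl⟩
    change ρ g (ρ q.out w) ∈ Submodule.span ℂ (Set.range v)
    rw [← Module.End.mul_apply, ← map_mul]
    exact hv _⟩
  have hM : M = ⊤ := by
    refine (eq_bot_or_eq_top M).resolve_left fun h => hw0 ?_
    have h' : Submodule.span ℂ (Set.range v) = ⊥ := congrArg Subrepresentation.toSubmodule h
    have := hv 1
    rw [h', Submodule.mem_bot, map_one] at this
    exact this
  have hM' : Submodule.span ℂ (Set.range v) = ⊤ := congrArg Subrepresentation.toSubmodule hM
  have := Fintype.ofFinite (G ⧸ A)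
  rw [Subgroup.index, Nat.card_eq_fintype_card, ← finrank_top, ← hM']
  exact finrank_range_le_card v

theorem commute_of_finrank_eq {G V : Type*} [Group G] [AddCommGroup V] [Module ℂ V]
    [FiniteDimensional ℂ V] {p : ℕ} (hp : p.Prime) (ρ : Representation ℂ G V) [IsIrreducible ρ]
    (hρ : Function.Injective ρ) (hV : finrank ℂ V = p)
    (hZ : ∀ z ∈ Subgroup.center G, z ^ p = 1) {x : G} (hx : x ∉ Subgroup.center G)
    (hxc : ∀ g : G, g * x * g⁻¹ * x⁻¹ ∈ Subgroup.center G) {a a' : G} (ha : Commute a x)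
    (ha' : Commute a' x) : Commute a a' := by
  have := nontrivial_of_isIrreducible ρ
  obtain ⟨g, hg⟩ : ∃ g, g * x * g⁻¹ * x⁻¹ ≠ 1 := by
    by_contra! h
    refine hx (Subgroup.mem_center_iff.2 fun g => ?_)
    have := h g
    rwa [mul_inv_eq_one, mul_inv_eq_iff_eq_mul] at this
  obtain ⟨ω, hω⟩ := exists_eq_smul_one_of_commute ρ (ρ (g * x * g⁻¹ * x⁻¹)) fun h v => by
    rw [← Module.End.mul_apply, ← map_mul, ← Module.End.mul_apply, ← map_mul,
      Subgroup.mem_center_iff.1 (hxc g) h]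
  have hω1 : ω ≠ 1 := by
    rintro rfl
    rw [one_smul] at hω
    exact hg (hρ (hω.trans (map_one ρ).symm))
  have hωp : ω ^ p = 1 := by
    have h1 : (ω • (1 : End ℂ V)) ^ p = 1 := by
      rw [← hω, ← map_pow, hZ _ (hxc g), map_one]
    obtain ⟨v, hv⟩ := exists_ne (0 : V)
    have h2 := LinearMap.congr_fun h1 v
    rw [smul_pow, one_pow, LinearMap.smul_apply, Module.End.one_apply] at h2
    by_contra hne
    have h3 : (ω ^ p - 1) • v = 0 := by rw [sub_smul, h2, one_smul, sub_self]
    exact (smul_eq_zero.1 h3).elim (fun h => hne (sub_eq_zero.1 h)) hv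
  have hprim : IsPrimitiveRoot ω p := by
    have : Fact p.Prime := ⟨hp⟩
    rw [← orderOf_eq_prime hωp hω1]
    exact IsPrimitiveRoot.orderOf ω
  have hgx : ρ g * ρ x = ω • (ρ x * ρ g) := by
    have : g * x = (g * x * g⁻¹ * x⁻¹) * (x * g) := by group
    rw [← map_mul, this, map_mul, hω, smul_mul_assoc, one_mul, map_mul]
  obtain ⟨μ, hμ⟩ := Module.End.exists_eigenvalue (ρ x)
  obtain ⟨v, hv⟩ := hμ.exists_hasEigenvector
  have hinj (h : G) (v : V) (hv : v ≠ 0) : ρ h v ≠ 0 := fun h0 => hv <| by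
    have : ρ h⁻¹ (ρ h v) = v := by rw [← Module.End.mul_apply, ← map_mul]; simp
    rw [← this, h0, map_zero]
  have hμ0 : μ ≠ 0 := by
    rintro rfl
    exact hinj x v hv.2 (by rw [hv.apply_eq_smul, zero_smul])
  have hω0 : ω ≠ 0 := hprim.ne_zero hp.ne_zero
  have hstep (ν : ℂ) (u : V) (hu : ρ x u = ν • u) : ρ x (ρ g u) = (ω⁻¹ * ν) • ρ g u := by
    have h1 := LinearMap.congr_fun hgx u
    rw [Module.End.mul_apply, hu, map_smul, LinearMap.smul_apply, Module.End.mul_apply] at h1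
    rw [mul_smul, h1, smul_smul, inv_mul_cancel₀ hω0, one_smul]
  have hvec (i : ℕ) : ρ x (ρ (g ^ i) v) = (ω⁻¹ ^ i * μ) • ρ (g ^ i) v := by
    induction i with
    | zero => simpa using hv.apply_eq_smul
    | succ i ih =>
      rw [pow_succ', map_mul, Module.End.mul_apply, hstep _ _ ih, pow_succ', mul_assoc]
  let ev : Fin p → ℂ := fun i => ω⁻¹ ^ (i : ℕ) * μ
  have hev : Function.Injective ev := fun i j hij =>
    Fin.ext (hprim.inv.pow_inj i.2 j.2 (mul_right_cancel₀ hμ0 hij))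
  have hlin : LinearIndependent ℂ fun i : Fin p => ρ (g ^ (i : ℕ)) v :=
    Module.End.eigenvectors_linearIndependent' (ρ x) ev hev _ fun i =>
      ⟨Module.End.mem_eigenspace_iff.2 (hvec i), hinj _ _ hv.2⟩
  have : Nonempty (Fin p) := ⟨⟨0, hp.pos⟩⟩
  let B := basisOfLinearIndependentOfCardEqFinrank hlin (by rw [Fintype.card_fin, hV])
  have hB (i : Fin p) : ρ x (B i) = ev i • B i := by
    simp only [B, coe_basisOfLinearIndependentOfCardEqFinrank]
    exact hvec i
  have := commute_of_commute_of_basis B hev hB (ha.map ρ) (ha'.map ρ)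
  exact hρ (by rw [map_mul, map_mul]; exact this)

theorem finrank_le_of_finrank_eq {G V W : Type*} [Group G] [Finite G] [AddCommGroup V] [Module ℂ V]
    [FiniteDimensional ℂ V] [AddCommGroup W] [Module ℂ W] [FiniteDimensional ℂ W] {p : ℕ}
    (hp : p.Prime) (hG : IsPGroup p G) (hZ : Nat.card (Subgroup.center G) = p)
    (hna : Subgroup.center G ≠ ⊤) (ρ : Representation ℂ G V) [IsIrreducible ρ]
    (hρ : Function.Injective ρ) (hV : finrank ℂ V = p) (σ : Representation ℂ G W)
    [IsIrreducible σ] : finrank ℂ W ≤ p := by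
  have : Fact p.Prime := ⟨hp⟩
  obtain ⟨x, hx, hxc⟩ := hG.exists_commutator_mem_center hna
  have hZp (z : G) (hz : z ∈ Subgroup.center G) : z ^ p = 1 := by
    have : (⟨z, hz⟩ : Subgroup.center G) ^ p = 1 := by rw [← hZ]; exact pow_card_eq_one'
    exact congrArg Subtype.val this
  let c := commutatorCenterHom x hxc
  have hc (a : G) (ha : a ∈ c.ker) : Commute a x := by
    have h1 : a * x * a⁻¹ * x⁻¹ = 1 := congrArg Subtype.val (MonoidHom.mem_ker.1 ha)
    rwa [mul_inv_eq_one, mul_inv_eq_iff_eq_mul] at h1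
  have : IsMulCommutative c.ker := ⟨⟨fun a a' => Subtype.ext
    (commute_of_finrank_eq hp ρ hρ hV hZp hx hxc (hc a a.2) (hc a' a'.2)).eq⟩⟩
  refine (finrank_le_index σ c.ker).trans ?_
  rw [Subgroup.index_ker, ← hZ]
  exact Subgroup.card_le_card_group c.range

end Representation

theorem Representation.finrank_mem_cdSet {G V : Type} [Group G] [Finite G] [AddCommGroup V]
    [Module ℂ V] [FiniteDimensional ℂ V] (ρ : Representation ℂ G V) [IsIrreducible ρ] :
    finrank ℂ V ∈ cdSet G :=
  ⟨FDRep.of ρ, (FDRep.simple_iff_isIrreducible _).2 ‹_›, rfl⟩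

theorem Representation.mul_comm_of_finrank_eq_one {G V : Type*} [Group G] [AddCommGroup V]
    [Module ℂ V] (ρ : Representation ℂ G V) (hρ : Function.Injective ρ) (hV : finrank ℂ V = 1)
    (x y : G) : x * y = y * x := by
  obtain ⟨v, -, hv⟩ := finrank_eq_one_iff'.1 hV
  apply hρ
  rw [map_mul, map_mul]
  obtain ⟨c, hc⟩ := hv (ρ x v)
  obtain ⟨d, hd⟩ := hv (ρ y v)
  ext w
  obtain ⟨a, rfl⟩ := hv w
  simp only [Module.End.mul_apply, map_smul, ← hc, ← hd]
  rw [smul_comm c d]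

end

theorem stmt15 (G : Type) [Group G] [Finite G] (p n e b α : ℕ) (hp : p.Prime)
    (hcard : Nat.card G = p ^ n) (hna : ¬ ∀ x y : G, x * y = y * x)
    (hc : IsCyclic (Subgroup.center G))
    (hmax : p ^ e ∈ cdSet G ∧ ∀ d ∈ cdSet G, d ≤ p ^ e)
    (hexp : Monoid.exponent G = p ^ b)
    (hα : sInf {d | ∃ V : FDRep ℂ G, Simple V ∧ Function.Injective V.ρ ∧
      Module.finrank ℂ V = d} = p ^ α) :
    (p ^ α * Nat.card (Subgroup.center G) ∣ quasiPermDegree G ∧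
      quasiPermDegree G ∣ p ^ (e + b)) ∧
    (cdSet G = {1, p, p ^ e} → 1 < e → Monoid.exponent G = p →
      quasiPermDegree G = p ^ (e + 1)) := by
  have : Fact p.Prime := ⟨hp⟩
  have hpG : IsPGroup p G := IsPGroup.of_card hcard
  have hcomm : center G ≠ ⊤ := fun h =>
    hna fun x y => (mem_center_iff.1 (h ▸ mem_top y : y ∈ center G) x)
  have : Nontrivial G := by
    by_contra h
    rw [not_nontrivial_iff_subsingleton] at h
    exact hna fun x y => Subsingleton.elim _ _
  have : Fintype G := Fintype.ofFinite G
  obtain ⟨k, hk⟩ : ∃ k, Nat.card (center G) = p ^ (k + 1) := by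
    obtain ⟨m, hm0, hm⟩ := (hpG.to_subgroup (center G)).nontrivial_iff_card.1 hpG.center_nontrivial
    exact ⟨m - 1, by rw [hm, Nat.sub_add_cancel hm0]⟩
  obtain ⟨b, rfl⟩ : ∃ c, b = c + 1 := by
    refine Nat.exists_eq_succ_of_ne_zero ?_
    rintro rfl
    rw [pow_zero, Monoid.exp_eq_one_iff] at hexp
    exact not_subsingleton G hexp
  obtain ⟨_, V, hV, hVi, rfl⟩ := Nat.nonempty_of_pos_sInf (hα ▸ pow_pos hp.pos α)
  have hV' := (FDRep.simple_iff_isIrreducible V).1 hV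
  obtain ⟨m, S, ρ, q, hρ, hρi, hkq, hqb, hdeg⟩ :=
    Representation.exists_quasiPermDegree_eq V.ρ hVi hp hpG
      (fun g => hexp ▸ Monoid.pow_exponent_eq_one g) hk
  have hS := ρ.finrank_mem_cdSet
  obtain ⟨s, -, hs⟩ := (Nat.dvd_prime_pow hp).1 (hcard ▸ ρ.finrank_dvd_card)
  refine ⟨⟨?_, ?_⟩, fun hcd he hexp' => ?_⟩
  · have hle : p ^ α ≤ p ^ s := hα ▸ hs ▸ Nat.sInf_le
      ⟨FDRep.of ρ, (FDRep.simple_iff_isIrreducible _).2 hρ, hρi, rfl⟩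
    rw [hdeg, hk, hs, pow_succ', mul_comm]
    exact mul_dvd_mul (mul_dvd_mul_left p hkq)
      (pow_dvd_pow p ((Nat.pow_le_pow_iff_right hp.one_lt).1 hle))
  · have hle : p ^ s ≤ p ^ e := hs ▸ hmax.2 _ hS
    rw [hdeg, hs, pow_add, pow_succ', mul_comm]
    exact mul_dvd_mul (pow_dvd_pow p ((Nat.pow_le_pow_iff_right hp.one_lt).1 hle))
      (mul_dvd_mul_left p hqb)
  · have hb : b = 0 := by
      have := Nat.pow_right_injective hp.two_le
        ((hexp.symm.trans hexp').trans (pow_one p).symm)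
      omega
    subst hb
    obtain rfl : q = 1 := by simpa using hqb
    obtain rfl : k = 0 := by
      by_contra hk0
      exact hp.one_lt.ne' (Nat.pow_eq_one.1 (Nat.dvd_one.1 hkq) |>.resolve_right hk0)
    rw [hdeg, mul_one, pow_succ']
    congr 1
    rw [hcd] at hS
    rcases hS with h | h | h
    · exact absurd (ρ.mul_comm_of_finrank_eq_one hρi h) hna
    · obtain ⟨W, hW, hWe⟩ := hmax.1
      have hW' := (FDRep.simple_iff_isIrreducible W).1 hW
      have hle := Representation.finrank_le_of_finrank_eq hp hpG (hk.trans (by simp)) hcomm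
        ρ hρi h W.ρ
      rw [hWe] at hle
      have := (Nat.pow_le_pow_iff_right hp.one_lt).1 (hle.trans_eq (pow_one p).symm)
      omega
    · exact h
end

section
/- Let G be a finite non-abelian p-group with an elementary abelian normal subgroup A of index p in G. Then for every irreducible character χ of G of degree p, the field of values ℚ(χ) equals ℚ(ω_p), the p-th cyclotomic field, provided χ restricted to A has a nontrivial irreducible constituent. -/
open FDRep CategoryTheory Subgroup

/-- A nonzero stable subspace of a simple representation is everything. -/
theorem FDRep.eq_top_of_simple {k : Type} [Field k] {G : Type} [Group G] (V : FDRep k G)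
    [Simple V] (W : Submodule k V) (hW : ∀ g, ∀ w ∈ W, V.ρ g w ∈ W) (hne : W ≠ ⊥) : W = ⊤ := by
  let σ : Representation k G W :=
    (Subrepresentation.mk (ρ := V.ρ) W fun g w hw ↦ hW g w hw).toRepresentation
  let f : FDRep.of σ ⟶ V :=
    { hom := FGModuleCat.ofHom W.subtype
      comm := fun g ↦ by ext w; rfl }
  have hf (w : W) : (ConcreteCategory.hom f) w = (w : V) := rfl
  have : Mono f := ConcreteCategory.mono_of_injective f fun a b h ↦ Subtype.ext h
  have hf0 : f ≠ 0 := by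
    rintro h
    obtain ⟨w, hw, hw0⟩ := W.exists_mem_ne_zero_of_ne_bot hne
    apply hw0
    have h0 := hf ⟨w, hw⟩
    rw [h] at h0
    exact h0.symm
  have : IsIso f := isIso_of_mono_of_nonzero hf0
  have hb := (ConcreteCategory.bijective_of_isIso f).surjective
  rw [eq_top_iff]
  rintro v -
  obtain ⟨w, hw⟩ := hb v
  rw [← hw]
  exact Subtype.property (p := (· ∈ W)) w

theorem Subgroup.exists_inv_pow_mul_mem_of_prime_index {G : Type*} [Group G] {A : Subgroup G}
    [A.Normal] {p : ℕ} (hp : p.Prime) (hA : A.index = p) {x : G} (hx : x ∉ A) (g : G) :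
    ∃ i : Fin p, (x ^ (i : ℕ))⁻¹ * g ∈ A := by
  have : Fact p.Prime := ⟨hp⟩
  have hx' : (x : G ⧸ A) ≠ 1 := by rwa [Ne, QuotientGroup.eq_one_iff]
  obtain ⟨m, hm⟩ := mem_powers_of_prime_card (g' := (g : G ⧸ A)) hA hx'
  have hxp : (x : G ⧸ A) ^ p = 1 := by
    rw [← hA, Subgroup.index]
    exact pow_card_eq_one'
  refine ⟨⟨m % p, Nat.mod_lt _ hp.pos⟩, ?_⟩
  rw [← QuotientGroup.eq, QuotientGroup.mk_pow, ← hm]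
  exact (pow_eq_pow_mod m hxp).symm

section WeightVector

variable {k G V : Type*} [Field k] [Group G] [AddCommGroup V] [Module k V]
  {ρ : Representation k G V} {A : Subgroup G} [A.Normal] {p : ℕ} {φ : A →* kˣ} {v : V} {x : G}

/-- The translates of a weight vector by the powers of an element outside `A` form a basis. -/
theorem Representation.exists_basis_pow_apply (hp : p.Prime) (hA : A.index = p)
    (hdeg : Module.finrank k V = p)
    (hirr : ∀ W : Submodule k V, (∀ g, ∀ w ∈ W, ρ g w ∈ W) → W ≠ ⊥ → W = ⊤)
    (hv0 : v ≠ 0) (hv : ∀ a : A, ρ a v = (φ a : k) • v) (hx : x ∉ A) :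
    ∃ b : Module.Basis (Fin p) k V, ∀ i, b i = ρ (x ^ (i : ℕ)) v := by
  have hspan : Submodule.span k (Set.range fun g ↦ ρ g v) = ⊤ := by
    refine hirr _ (fun g w hw ↦ ?_) fun h ↦ hv0 ?_
    · induction hw using Submodule.span_induction with
      | mem w hw =>
        obtain ⟨h, rfl⟩ := hw
        exact Submodule.subset_span ⟨g * h, by simp⟩
      | zero => simp
      | add y z _ _ hy hz => rw [map_add]; exact add_mem hy hz
      | smul c y _ hy => rw [map_smul]; exact Submodule.smul_mem _ _ hy
    · rw [Submodule.span_eq_bot] at h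
      simpa using h (ρ 1 v) ⟨1, rfl⟩
  have htop : ⊤ ≤ Submodule.span k (Set.range fun i : Fin p ↦ ρ (x ^ (i : ℕ)) v) := by
    rw [← hspan, Submodule.span_le]
    rintro _ ⟨g, rfl⟩
    obtain ⟨i, hi⟩ := A.exists_inv_pow_mul_mem_of_prime_index hp hA hx g
    have : ρ g v = (φ ⟨_, hi⟩ : k) • ρ (x ^ (i : ℕ)) v := by
      rw [← map_smul, ← hv, ← Module.End.mul_apply, ← map_mul, mul_inv_cancel_left]
    simp only [SetLike.mem_coe, this]
    exact Submodule.smul_mem _ _ (Submodule.subset_span ⟨i, rfl⟩)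
  exact ⟨basisOfTopLeSpanOfCardEqFinrank _ htop (by simp [hdeg]), fun i ↦ by simp⟩

theorem Representation.trace_eq_zero_of_notMem (hp : p.Prime) (hA : A.index = p)
    (hv : ∀ a : A, ρ a v = (φ a : k) • v) (hx : x ∉ A)
    (b : Module.Basis (Fin p) k V) (hb : ∀ i, b i = ρ (x ^ (i : ℕ)) v) :
    LinearMap.trace k V (ρ x) = 0 := by
  rw [LinearMap.trace_eq_matrix_trace k b, Matrix.trace]
  refine Finset.sum_eq_zero fun i _ ↦ ?_
  obtain ⟨j, hj⟩ := A.exists_inv_pow_mul_mem_of_prime_index hp hA hx (x * x ^ (i : ℕ))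
  have hij : j ≠ i := by
    rintro rfl
    rw [← pow_succ', pow_succ, inv_mul_cancel_left] at hj
    exact hx hj
  have : ρ x (b i) = (φ ⟨_, hj⟩ : k) • b j := by
    rw [hb, hb, ← map_smul, ← hv, ← Module.End.mul_apply, ← map_mul, ← Module.End.mul_apply,
      ← map_mul, mul_inv_cancel_left]
  simp [LinearMap.toMatrix_apply, this, hij]

theorem Representation.trace_eq_sum_of_mem (hv : ∀ a : A, ρ a v = (φ a : k) • v)
    (b : Module.Basis (Fin p) k V) (hb : ∀ i, b i = ρ (x ^ (i : ℕ)) v) (a : A) :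
    LinearMap.trace k V (ρ a) =
      ∑ i : Fin p, (φ (MulAut.conjNormal (x ^ (i : ℕ))⁻¹ a) : k) := by
  rw [LinearMap.trace_eq_matrix_trace k b, Matrix.trace]
  refine Finset.sum_congr rfl fun i _ ↦ ?_
  have : ρ a (b i) = (φ (MulAut.conjNormal (x ^ (i : ℕ))⁻¹ a) : k) • b i := by
    rw [hb, ← map_smul, ← hv, ← Module.End.mul_apply, ← map_mul, ← Module.End.mul_apply,
      ← map_mul, MulAut.conjNormal_apply]
    congr 2
    group
  simp [LinearMap.toMatrix_apply, this]

end WeightVector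

/-- If `φ` occurs in the restriction of `ρ` to `A`, then `ρ` has a weight vector for `φ`. -/
theorem Representation.exists_weight_vector {k G V : Type*} [Field k] [Group G] [AddCommGroup V]
    [Module k V] (ρ : Representation k G V) (A : Subgroup G) [Fintype A] (φ : A →* kˣ)
    (h : ∑ a : A, LinearMap.trace k V (ρ a) * ((φ a)⁻¹ : kˣ) ≠ 0) :
    ∃ v : V, v ≠ 0 ∧ ∀ a : A, ρ a v = (φ a : k) • v := by
  set e : V →ₗ[k] V := ∑ a : A, (((φ a)⁻¹ : kˣ) : k) • ρ a
  have he : e ≠ 0 := by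
    refine fun h0 ↦ h ?_
    rw [← map_zero (LinearMap.trace k V), ← h0, map_sum]
    exact Finset.sum_congr rfl fun a _ ↦ by rw [map_smul, smul_eq_mul, mul_comm]
  obtain ⟨w, hw⟩ : ∃ w, e w ≠ 0 := by
    by_contra! h0
    exact he (LinearMap.ext h0)
  refine ⟨e w, hw, fun c ↦ ?_⟩
  simp only [e, LinearMap.sum_apply, LinearMap.smul_apply, map_sum, map_smul, Finset.smul_sum]
  refine Fintype.sum_equiv (Equiv.mulLeft c) _ _ fun a ↦ ?_
  rw [Equiv.coe_mulLeft, smul_smul, map_mul, mul_inv, Units.val_mul, Units.mul_inv_cancel_left,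
    Subgroup.coe_mul, map_mul, Module.End.mul_apply]

theorem MonoidHom.exists_eq_of_sum_eq_sum {k A ι κ : Type*} [Field k] [CharZero k] [Group A]
    [Finite A] [Fintype ι] [Fintype κ] (f : ι → A →* kˣ) (g : κ → A →* kˣ)
    (h : ∀ a, ∑ i, (f i a : k) = ∑ j, (g j a : k)) (i : ι) : ∃ j, f i = g j := by
  classical
  have := Fintype.ofFinite A
  have key (ψ : A →* kˣ) : ∑ a, (ψ a : k) * ((f i a)⁻¹ : kˣ) =
      if ψ = f i then (Fintype.card A : k) else 0 := by
    have h1 : (Units.coeHom k).comp (ψ * (f i)⁻¹) = 1 ↔ ψ = f i := by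
      rw [← mul_inv_eq_one (a := ψ)]
      simp [MonoidHom.ext_iff, Units.ext_iff]
    have := sum_hom_units ((Units.coeHom k).comp (ψ * (f i)⁻¹))
    simp only [h1] at this
    simpa using this
  by_contra! hne
  have h2 : ∑ a, (∑ j, (f j a : k)) * ((f i a)⁻¹ : kˣ) = 0 := by
    simp only [h, Finset.sum_mul]
    rw [Finset.sum_comm]
    exact Finset.sum_eq_zero fun j _ ↦ by rw [key, if_neg (hne j).symm]
  simp only [Finset.sum_mul] at h2
  rw [Finset.sum_comm] at h2
  simp only [key, ← Finset.sum_filter, Finset.sum_const, nsmul_eq_mul, mul_eq_zero,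
    Nat.cast_eq_zero, Finset.card_eq_zero, Fintype.card_ne_zero, or_false] at h2
  exact Finset.notMem_empty i (h2 ▸ by simp)

/-- If an automorphism `τ` with `τ ^ p = 1` sends a nontrivial character `φ` of exponent `p` to its
power `φ ^ m`, then `m ≡ 1` modulo `p`. -/
theorem MonoidHom.modEq_one_of_pow_eq_comp {A M : Type*} [Group A] [CommGroup M] {p : ℕ}
    (hp : p.Prime) {φ : A →* M} (hφ : φ ≠ 1) (hexp : ∀ a, φ a ^ p = 1) {τ : MulAut A}
    (hτ : τ ^ p = 1) {m : ℕ} (h : ∀ a, φ a ^ m = φ (τ a)) : m ≡ 1 [MOD p] := by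
  have : Fact p.Prime := ⟨hp⟩
  have hiter (n : ℕ) (a : A) : φ a ^ m ^ n = φ ((τ ^ n) a) := by
    induction n generalizing a with
    | zero => simp
    | succ n ih => rw [pow_succ, pow_mul, ih, h, pow_succ', MulAut.mul_apply]
  obtain ⟨a, ha⟩ : ∃ a, φ a ≠ 1 := by
    by_contra! h0
    exact hφ (MonoidHom.ext h0)
  have h1 : φ a ^ m ^ p = φ a ^ 1 := by rw [hiter, hτ, MulAut.one_apply, pow_one]
  rw [pow_eq_pow_iff_modEq, orderOf_eq_prime (hexp a) ha] at h1
  rw [← ZMod.natCast_eq_natCast_iff] at h1 ⊢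
  simpa using h1

/-- A relation `∑ i, ζ ^ m i = c` over a subfield persists for conjugates of `ζ`. -/
theorem IsConjRoot.sum_pow_eq {K L ι : Type*} [Field K] [Field L] [Algebra K L] [Fintype ι]
    {x y : L} (h : IsConjRoot K x y) (m : ι → ℕ) {c : K}
    (hc : ∑ i, x ^ m i = algebraMap K L c) : ∑ i, y ^ m i = algebraMap K L c := by
  have hdvd : minpoly K x ∣ ∑ i, (Polynomial.X : Polynomial K) ^ m i - Polynomial.C c :=
    minpoly.dvd K x (by simp [hc])
  rw [h] at hdvd
  have := Polynomial.aeval_eq_zero_of_dvd_aeval_eq_zero hdvd (minpoly.aeval K y)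
  simpa [sub_eq_zero] using this

theorem stmt17 (G : Type) [Group G] [Finite G] (p n : ℕ) (hp : p.Prime)
    (hcard : Nat.card G = p ^ n) (hna : ¬ ∀ x y : G, x * y = y * x)
    (A : Subgroup G) (hA : A.Normal) (hab : ∀ a b : A, a * b = b * a)
    (helem : ∀ a : A, a ^ p = 1) (hAi : A.index = p)
    (V : FDRep ℂ G) (hV : Simple V) (hdeg : Module.finrank ℂ V = p)
    (φ : A →* ℂˣ) (hφ : φ ≠ 1)
    (hconst : (∑ᶠ a : A, V.character (a : G) * star ((φ a : ℂ))) ≠ 0) :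
    IntermediateField.adjoin ℚ (Set.range V.character) =
      IntermediateField.adjoin ℚ {Complex.exp (2 * Real.pi * Complex.I / p)} := by
  have : Fintype A := Fintype.ofFinite A
  have : NeZero p := ⟨hp.ne_zero⟩
  have hζ := Complex.isPrimitiveRoot_exp p hp.ne_zero
  set ζ : ℂ := Complex.exp (2 * Real.pi * Complex.I / p)
  have hφp (a : A) : φ a ^ p = 1 := by rw [← map_pow, helem, map_one]
  have hφp' (a : A) : (φ a : ℂ) ^ p = 1 := by
    rw [← Units.val_pow_eq_pow_val, hφp, Units.val_one]
  obtain ⟨v, hv0, hv⟩ := Representation.exists_weight_vector V.ρ A φ (by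
    rw [finsum_eq_sum_of_fintype] at hconst
    convert hconst using 1
    refine Finset.sum_congr rfl fun a _ ↦ congrArg (V.character a * ·) ?_
    rw [Units.val_inv_eq_inv_val]
    exact Complex.inv_eq_conj (Complex.norm_eq_one_of_pow_eq_one (hφp' a) hp.ne_zero))
  have hbasis {x : G} (hx : x ∉ A) := Representation.exists_basis_pow_apply hp hAi hdeg
    (FDRep.eq_top_of_simple V) hv0 hv hx
  have hχ0 (g : G) (hg : g ∉ A) : V.character g = 0 := by
    obtain ⟨b, hb⟩ := hbasis hg
    exact Representation.trace_eq_zero_of_notMem hp hAi hv hg b hb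
  obtain ⟨x, hx⟩ : ∃ x, x ∉ A := by
    by_contra! h
    exact hp.ne_one (hAi ▸ Subgroup.index_eq_one.mpr (A.eq_top_iff' |>.mpr h))
  have hχA (a : A) : V.character a =
      ∑ i : Fin p, (φ (MulAut.conjNormal (x ^ (i : ℕ))⁻¹ a) : ℂ) := by
    obtain ⟨b, hb⟩ := hbasis hx
    exact Representation.trace_eq_sum_of_mem hv b hb a
  choose e he using fun a ↦ hζ.eq_pow_of_pow_eq_one (hφp' a)
  apply le_antisymm
  · rw [IntermediateField.adjoin_le_iff]
    rintro _ ⟨g, rfl⟩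
    by_cases hg : g ∈ A
    · rw [SetLike.mem_coe, hχA ⟨g, hg⟩]
      refine sum_mem fun i _ ↦ ?_
      rw [← (he _).2]
      exact pow_mem (IntermediateField.mem_adjoin_simple_self ℚ ζ) _
    · rw [hχ0 g hg]
      exact zero_mem _
  · set L := IntermediateField.adjoin ℚ (Set.range V.character)
    rw [IntermediateField.adjoin_simple_le_iff]
    by_contra hζL
    have hint : IsIntegral L ζ := hζ.isIntegral hp.pos |>.tower_top
    obtain ⟨ζ', hne, hconj⟩ := (notMem_iff_exists_ne_and_isConjRoot
      (minpoly.irreducible hint).separable (IsAlgClosed.splits _)).mp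
      (show ζ ∉ (⊥ : Subalgebra L ℂ) by
        rintro ⟨y, hy⟩
        exact hζL (hy ▸ y.2))
    have hζ' : ζ' ^ p = 1 := by
      have := hconj.sum_pow_eq (fun _ : Unit ↦ p) (c := 1) (by simp [hζ.pow_eq_one])
      simpa using this
    obtain ⟨m, -, rfl⟩ := hζ.eq_pow_of_pow_eq_one hζ'
    obtain ⟨j, hj⟩ := MonoidHom.exists_eq_of_sum_eq_sum
      (fun i : Fin p ↦ (φ.comp (MulAut.conjNormal (x ^ (i : ℕ))⁻¹ : MulAut A).toMonoidHom) ^ m)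
      (fun i : Fin p ↦ φ.comp (MulAut.conjNormal (x ^ (i : ℕ))⁻¹ : MulAut A).toMonoidHom)
      (fun a ↦ by
        have hsum : ∑ i : Fin p, ζ ^ e (MulAut.conjNormal (x ^ (i : ℕ))⁻¹ a) =
            V.character a := by
          rw [hχA]
          exact Finset.sum_congr rfl fun i _ ↦ (he _).2
        have := hconj.sum_pow_eq _
          (c := ⟨V.character a, IntermediateField.subset_adjoin _ _ ⟨_, rfl⟩⟩) hsum
        refine Eq.trans ?_ (this.trans (hχA a))
        refine Finset.sum_congr rfl fun i _ ↦ ?_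
        rw [← pow_mul, mul_comm, pow_mul, (he _).2]
        rfl) 0
    have hτ : (MulAut.conjNormal (x ^ (j : ℕ))⁻¹ : MulAut A) ^ p = 1 := by
      have hxp : (x ^ (j : ℕ)) ^ p ∈ A := by
        simpa only [hAi] using A.pow_index_mem (x ^ (j : ℕ))
      rw [← map_pow, inv_pow]
      ext a
      have hc := congrArg Subtype.val (hab ⟨_, inv_mem hxp⟩ a)
      simp only [Subgroup.coe_mul] at hc
      rw [MulAut.conjNormal_apply, hc, mul_inv_cancel_right, MulAut.one_apply]
    have hm := MonoidHom.modEq_one_of_pow_eq_comp hp hφ hφp hτ (m := m) fun a ↦ by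
      simpa using DFunLike.congr_fun hj a
    apply hne
    rw [pow_eq_pow_mod m hζ.pow_eq_one, hm, ← pow_eq_pow_mod 1 hζ.pow_eq_one, pow_one]
end
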